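/- arXiv:2311.06639 — 3 statements merged into one kernel-verified Lean document; each statement's English description precedes it below -/
import Mathlib

section
/- Let d ≥ 2, let p_1,…,p_d ∈ ℝ^d and let P be the d×d matrix whose i-th column is p_i. With t_d := 0, T_1 := 1, T_j := t_1⋯t_{j−1} for j ≥ 2, define η(t_1,…,t_{d−1}) := ∑_{j=1}^d T_j(1−t_j) p_j and ψ(t_1,…,t_{d−1}) := ∏_{i=1}^{d−2} t_i^{d−1−i}. Then for every r > 0 and t = (t_1,…,t_{d−1}) ∈ (0,1)^{d−1}, the absolute value of the Jacobian determinant of the map (r,t) ↦ r·η(t) (as a map from (0,∞)×(0,1)^{d−1} ⊂ ℝ^d to ℝ^d) equals |det P| · ψ(t) · r^{d−1}. -/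
open MeasureTheory

/-- Stick-breaking barycentric coefficients `T_j (1 - t_j)` (0-based indices). -/
noncomputable def stickCoeff (d : ℕ) (t : Fin (d - 1) → ℝ) (j : Fin d) : ℝ :=
  (∏ k ∈ Finset.univ.filter (fun k : Fin (d - 1) => (k : ℕ) < (j : ℕ)), t k) *
    (1 - if h : (j : ℕ) < d - 1 then t ⟨j, h⟩ else 0)

/-- The repeated-linear-interpolation parametrization `η(t) = ∑ j T_j (1-t_j) p_j`. -/
noncomputable def etaMap {d : ℕ} {E : Type*} [AddCommGroup E] [Module ℝ E]
    (p : Fin d → E) (t : Fin (d - 1) → ℝ) : E :=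
  ∑ j : Fin d, stickCoeff d t j • p j

/-- The density factor `ψ(t) = ∏_{i=1}^{d-2} t_i^{d-1-i}` (0-based indices). -/
noncomputable def psiMap (d : ℕ) (t : Fin (d - 1) → ℝ) : ℝ :=
  ∏ k : Fin (d - 1), t k ^ (d - 2 - (k : ℕ))

/-- The matrix sending `y` to its successive differences `y j - y (j + 1)` (with `y d = 0`). -/
def differenceMatrix (d : ℕ) : Matrix (Fin d) (Fin d) ℝ :=
  Matrix.of fun i j => if i = j then 1 else if (j : ℕ) = i + 1 then -1 else 0

lemma det_differenceMatrix (d : ℕ) : (differenceMatrix d).det = 1 := by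
  rw [Matrix.det_of_isUpperTriangular]
  · simp [differenceMatrix]
  · intro i j hij
    simp only [id_eq] at hij
    have h1 : i ≠ j := by rintro rfl; exact lt_irrefl _ hij
    have h2 : (j : ℕ) ≠ i + 1 := by have : (j : ℕ) < i := hij; omega
    simp [differenceMatrix, h1, h2]

lemma differenceMatrix_mulVec {d : ℕ} (y : Fin d → ℝ) (i : Fin d) :
    (differenceMatrix d).mulVec y i =
      y i - if h : (i : ℕ) + 1 < d then y ⟨i + 1, h⟩ else 0 := by
  have key : ∀ j : Fin d, differenceMatrix d i j * y j =
      (if i = j then y j else 0) - if (j : ℕ) = i + 1 then y j else 0 := by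
    intro j
    by_cases h1 : i = j
    · subst h1; simp [differenceMatrix]
    · by_cases h2 : (j : ℕ) = i + 1 <;> simp [differenceMatrix, h1, h2]
  simp only [Matrix.mulVec, dotProduct, key, Finset.sum_sub_distrib]
  congr 1
  · simp
  · split_ifs with h
    · rw [Finset.sum_eq_single ⟨(i : ℕ) + 1, h⟩]
      · simp
      · intro b _ hb
        rw [if_neg]
        exact fun hb' => hb (Fin.ext hb')
      · simp
    · refine Finset.sum_eq_zero fun j _ => if_neg ?_
      have := j.isLt
      omega

/-- The partial products `u 0 * ⋯ * u j`. -/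
noncomputable def partialProd {d : ℕ} (u : Fin d → ℝ) (j : Fin d) : ℝ :=
  ∏ k ∈ Finset.Iic j, u k

/-- The Jacobian matrix of `partialProd`. -/
noncomputable def partialProdJacobian {d : ℕ} (u : Fin d → ℝ) : Matrix (Fin d) (Fin d) ℝ :=
  Matrix.of fun j k => if k ≤ j then ∏ l ∈ (Finset.Iic j).erase k, u l else 0

lemma hasFDerivAt_partialProd {d : ℕ} (u : Fin d → ℝ) :
    HasFDerivAt partialProd
      (LinearMap.toContinuousLinearMap (Matrix.toLin' (partialProdJacobian u))) u := by
  rw [hasFDerivAt_pi']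
  intro j
  have h := HasFDerivAt.finsetProd (u := Finset.Iic j) fun k _ =>
    (ContinuousLinearMap.proj (R := ℝ) (φ := fun _ : Fin d => ℝ) k).hasFDerivAt (x := u)
  refine h.congr_fderiv ?_
  ext v
  simp [partialProdJacobian, Matrix.mulVec, dotProduct, ite_mul, ← Finset.sum_filter,
    Finset.filter_ge_eq_Iic]

lemma det_partialProdJacobian {d : ℕ} (u : Fin d → ℝ) :
    (partialProdJacobian u).det = ∏ k : Fin d, u k ^ (d - 1 - (k : ℕ)) := by
  rw [Matrix.det_of_isLowerTriangular]
  · simp only [partialProdJacobian, Matrix.of_apply, le_refl, if_true, Finset.Iic_erase]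
    rw [Finset.prod_comm' (t' := Finset.univ) (s' := fun k => Finset.Ioi k) (by simp)]
    simp
  · intro i j hij
    have : ¬ j ≤ i := not_le.mpr hij
    simp [partialProdJacobian, this]

lemma mul_prod_filter_succ {n : ℕ} (u : Fin (n + 1) → ℝ) (j : Fin (n + 1)) :
    u 0 * ∏ k ∈ Finset.univ.filter (fun k : Fin n => (k : ℕ) < j), u k.succ =
      partialProd u j := by
  rw [partialProd, ← Finset.filter_ge_eq_Iic, Finset.prod_filter, Finset.prod_filter,
    Fin.prod_univ_succ]
  simp [Fin.le_def]

lemma partialProd_succ {d : ℕ} (u : Fin d → ℝ) (j : Fin d) (h : (j : ℕ) + 1 < d) :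
    partialProd u ⟨j + 1, h⟩ = partialProd u j * u ⟨j + 1, h⟩ := by
  have : Finset.Iic (⟨j + 1, h⟩ : Fin d) = insert ⟨j + 1, h⟩ (Finset.Iic j) := by
    ext k
    simp only [Finset.mem_Iic, Finset.mem_insert, Fin.le_def, Fin.ext_iff]
    omega
  rw [partialProd, this, Finset.prod_insert (by simp [Fin.le_def]), mul_comm, partialProd]

lemma mul_stickCoeff {n : ℕ} (u : Fin (n + 1) → ℝ) (j : Fin (n + 1)) :
    u 0 * stickCoeff (n + 1) (fun k : Fin n => u k.succ) j =
      (differenceMatrix (n + 1)).mulVec (partialProd u) j := by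
  rw [differenceMatrix_mulVec, stickCoeff, ← mul_assoc]
  refine (congrArg (· * _) (mul_prod_filter_succ u j)).trans ?_
  simp only [Nat.add_sub_cancel]
  by_cases h : (j : ℕ) < n
  · rw [dif_pos h, dif_pos (by omega), partialProd_succ]
    simp only [Fin.succ_mk]
    ring
  · rw [dif_neg h, dif_neg (by omega)]
    ring

lemma smul_etaMap {n : ℕ} (p : Fin (n + 1) → Fin (n + 1) → ℝ) (u : Fin (n + 1) → ℝ) :
    u 0 • etaMap p (fun k : Fin n => u k.succ) =
      ((Matrix.of fun i j => p j i) * differenceMatrix (n + 1)).mulVec (partialProd u) := by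
  rw [← Matrix.mulVec_mulVec]
  ext i
  simp only [etaMap, Finset.smul_sum, smul_smul, mul_stickCoeff]
  simp [Matrix.mulVec, dotProduct, mul_comm]

lemma det_fderiv_smul_etaMap {n : ℕ} (p : Fin (n + 1) → Fin (n + 1) → ℝ)
    (u : Fin (n + 1) → ℝ) :
    (fderiv ℝ (fun u : Fin (n + 1) → ℝ => u 0 • etaMap p (fun k : Fin n => u k.succ)) u).det =
      (Matrix.of fun i j => p j i).det * ∏ k : Fin (n + 1), u k ^ (n - (k : ℕ)) := by
  simp only [smul_etaMap]
  set A := (Matrix.of fun i j => p j i) * differenceMatrix (n + 1) with hA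
  have h : HasFDerivAt (fun u : Fin (n + 1) → ℝ => A.mulVec (partialProd u)) _ u :=
    (LinearMap.toContinuousLinearMap (Matrix.toLin' A)).hasFDerivAt.comp u
      (hasFDerivAt_partialProd u)
  rw [h.fderiv, ContinuousLinearMap.det, ContinuousLinearMap.toLinearMap_comp,
    LinearMap.det_comp, LinearMap.coe_toContinuousLinearMap,
    LinearMap.coe_toContinuousLinearMap, LinearMap.det_toLin', LinearMap.det_toLin', hA,
    Matrix.det_mul, det_differenceMatrix, det_partialProdJacobian, mul_one]
  rfl

/-- the absolute value of the Jacobian determinant of `(r,t) ↦ r·η(t)`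
equals `|det P| ψ(t) r^{d-1}`, where `P` is the matrix with columns `p_1,…,p_d`. -/
theorem abs_jacobian_simplex_param (d : ℕ) (hd : 2 ≤ d)
    (p : Fin d → (Fin d → ℝ)) (r : ℝ) (hr : 0 < r)
    (t : Fin (d - 1) → ℝ) (ht : ∀ k, t k ∈ Set.Ioo (0 : ℝ) 1) :
    |ContinuousLinearMap.det
      (fderiv ℝ
        (fun u : Fin d → ℝ =>
          u ⟨0, by omega⟩ • etaMap p (fun k => u ⟨(k : ℕ) + 1, by omega⟩))
        (fun j : Fin d => if h : (j : ℕ) = 0 then r else t ⟨(j : ℕ) - 1, by omega⟩))|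
    = |Matrix.det (Matrix.of fun i j => p j i)| * psiMap d t * r ^ (d - 1) := by
  obtain ⟨n, rfl⟩ : ∃ n, d = n + 1 := ⟨d - 1, by omega⟩
  have hnonneg : 0 ≤ psiMap (n + 1) t * r ^ n :=
    mul_nonneg (Finset.prod_nonneg fun k _ => pow_nonneg (ht k).1.le _) (pow_nonneg hr.le _)
  refine (congrArg abs (det_fderiv_smul_etaMap p _)).trans ?_
  rw [Fin.prod_univ_succ, abs_mul, mul_assoc]
  congr 1
  refine Eq.trans ?_ (abs_of_nonneg hnonneg)
  rw [mul_comm, psiMap]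
  congr 2
  refine Finset.prod_congr rfl fun k _ => ?_
  congr 1
  simp only [Fin.val_succ]
  omega
end

section
/- Let d ≥ 2, let q_1,…,q_d be unit vectors in ℝ^d and r_1,…,r_d > 0 be such that p_1 := r_1 q_1, …, p_d := r_d q_d are linearly independent, and let P be the d×d matrix whose j-th column is p_j. Fix i ∈ {1,…,d}, and for s > 0 let S(s) denote the convex hull of {0, p_1,…,p_{i−1}, s·q_i, p_{i+1},…,p_d}. With t_d := 0, T_1 := 1, T_j := t_1⋯t_{j−1}, let η_i(t_1,…,t_{d−1}) := ∑_{j=1}^d T_j(1−t_j) p_{σ(j)} where σ is the transposition of 1 and i (i.e. η with p_1 and p_i swapped), ψ(t) := ∏_{k=1}^{d−2} t_k^{d−1−k} and ψ̂(t) := (1−t_1)ψ(t). Then for every continuous g : ℝ^d → ℝ, the function s ↦ ∫_{S(s)} g(x) dx is differentiable at s = r_i with derivative (1/r_i) |det P| ∫_{(0,1)^{d−1}} g(η_i(t)) ψ̂(t) dt. -/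
open MeasureTheory

/-- The products `t₀ ⋯ t_k` of initial segments of `t`. -/
noncomputable def prefixProd {n : ℕ} (t : Fin n → ℝ) (k : Fin n) : ℝ :=
  ∏ l ∈ Finset.Iic k, t l

lemma prefixProd_eq {n : ℕ} (t : Fin n → ℝ) (k : Fin n) :
    prefixProd t k = (∏ l ∈ Finset.Iio k, t l) * t k :=
  (Finset.prod_Iio_mul_eq_prod_Iic k).symm

lemma prefixProd_zero {n : ℕ} (t : Fin (n + 1) → ℝ) : prefixProd t 0 = t 0 := by
  have : Finset.Iio (0 : Fin (n + 1)) = ∅ := by ext; simp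
  rw [prefixProd_eq, this, Finset.prod_empty, one_mul]

lemma prefixProd_succ {n : ℕ} (t : Fin (n + 1) → ℝ) (k : Fin n) :
    prefixProd t k.succ = prefixProd t k.castSucc * t k.succ := by
  have : Finset.Iio k.succ = Finset.Iic k.castSucc := by
    ext l
    simp [Fin.lt_def, Fin.le_def]
  rw [prefixProd_eq, this, prefixProd]

lemma eq_of_prefixProd_eq {n : ℕ} {t t' : Fin n → ℝ} (ht : ∀ k, 0 < t k)
    (h : ∀ k, prefixProd t k = prefixProd t' k) (k : Fin n) : t k = t' k := by
  induction k using WellFoundedLT.induction with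
  | ind k ih =>
    have hk := h k
    rw [prefixProd_eq, prefixProd_eq,
      ← Finset.prod_congr rfl fun l hl => ih l (Finset.mem_Iio.1 hl)] at hk
    exact mul_left_cancel₀ (Finset.prod_pos fun l _ => ht l).ne' hk

lemma prod_prod_Iio_eq_psiMap (m : ℕ) (t : Fin (m + 1) → ℝ) :
    ∏ k, ∏ l ∈ Finset.Iio k, t l = psiMap (m + 2) t := by
  rw [Finset.prod_comm' (t' := Finset.univ) (s' := fun l => Finset.Ioi l) (by simp)]
  refine Finset.prod_congr rfl fun l _ => ?_
  rw [Finset.prod_const, Fin.card_Ioi]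
  rfl

lemma stickCoeff_zero (m : ℕ) (t : Fin (m + 1) → ℝ) : stickCoeff (m + 2) t 0 = 1 - t 0 := by
  simp [stickCoeff]

lemma stickCoeff_succ (m : ℕ) (t : Fin (m + 1) → ℝ) (k : Fin (m + 1)) :
    stickCoeff (m + 2) t k.succ =
      prefixProd t k * (1 - if h : (k : ℕ) + 1 < m + 1 then t ⟨k + 1, h⟩ else 0) := by
  unfold stickCoeff prefixProd
  congr 1
  refine Finset.prod_congr ?_ fun _ _ => rfl
  ext l
  simp only [Finset.mem_filter, Finset.mem_univ, true_and, Finset.mem_Iic, Fin.val_succ,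
    Nat.lt_succ_iff]
  rfl

lemma stickCoeff_castSucc_succ (m : ℕ) (t : Fin (m + 1) → ℝ) (k : Fin m) :
    stickCoeff (m + 2) t k.castSucc.succ = prefixProd t k.castSucc - prefixProd t k.succ := by
  rw [stickCoeff_succ, prefixProd_succ, dif_pos (by simp)]
  simp only [Fin.val_castSucc, Fin.succ]
  ring

lemma stickCoeff_last (m : ℕ) (t : Fin (m + 1) → ℝ) :
    stickCoeff (m + 2) t (Fin.last m).succ = prefixProd t (Fin.last m) := by
  rw [stickCoeff_succ, dif_neg (by simp)]
  ring

lemma stickCoeff_pos {d : ℕ} {t : Fin (d - 1) → ℝ} (ht : ∀ k, t k ∈ Set.Ioo (0 : ℝ) 1)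
    (j : Fin d) : 0 < stickCoeff d t j := by
  refine mul_pos (Finset.prod_pos fun k _ => (ht k).1) ?_
  split_ifs with h
  · exact sub_pos.2 (ht _).2
  · simp

lemma sum_stickCoeff_succ (m : ℕ) (t : Fin (m + 1) → ℝ) :
    ∑ k : Fin (m + 1), stickCoeff (m + 2) t k.succ = t 0 := by
  rw [Fin.sum_univ_castSucc, stickCoeff_last]
  simp only [stickCoeff_castSucc_succ, Finset.sum_sub_distrib]
  have h := (Fin.sum_univ_castSucc (prefixProd t)).symm.trans (Fin.sum_univ_succ (prefixProd t))
  rw [prefixProd_zero] at h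
  linarith

lemma continuous_psiMap (d : ℕ) : Continuous (psiMap d) := by
  unfold psiMap
  fun_prop

lemma psiMap_nonneg {d : ℕ} {t : Fin (d - 1) → ℝ} (ht : ∀ k, 0 ≤ t k) : 0 ≤ psiMap d t :=
  Finset.prod_nonneg fun k _ => pow_nonneg (ht k) _

/-- Every point with positive coordinates summing to less than `1` consists of stick-breaking
coefficients. -/
lemma exists_stickCoeff_succ_eq (m : ℕ) {z : Fin (m + 1) → ℝ} (hz : ∀ k, 0 < z k)
    (hs : ∑ k, z k < 1) :
    ∃ t : Fin (m + 1) → ℝ, (∀ k, t k ∈ Set.Ioo (0 : ℝ) 1) ∧ t 0 = ∑ k, z k ∧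
      ∀ k, stickCoeff (m + 2) t k.succ = z k := by
  set S : Fin (m + 1) → ℝ := fun k => ∑ l ∈ Finset.Ici k, z l with hS
  have hSpos : ∀ k, 0 < S k := fun k => Finset.sum_pos (fun l _ => hz l) ⟨k, by simp⟩
  have hS0 : S 0 = ∑ k, z k := by
    rw [hS]
    exact Finset.sum_congr (by ext; simp) fun _ _ => rfl
  have hSlast : S (Fin.last m) = z (Fin.last m) := by
    have : Finset.Ici (Fin.last m) = {Fin.last m} := by
      ext l
      simp [Fin.last_le_iff]
    simp [hS, this]
  have hSsucc : ∀ k : Fin m, S k.castSucc = z k.castSucc + S k.succ := fun k => by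
    have : Finset.Ici k.castSucc = insert k.castSucc (Finset.Ici k.succ) := by
      ext l
      simp only [Finset.mem_Ici, Finset.mem_insert, Fin.le_def, Fin.ext_iff, Fin.val_castSucc,
        Fin.val_succ]
      omega
    simp only [hS]
    rw [this, Finset.sum_insert (by simp)]
  let t : Fin (m + 1) → ℝ := Fin.cons (S 0) fun k : Fin m => S k.succ / S k.castSucc
  have ht0 : t 0 = S 0 := rfl
  have htsucc : ∀ k : Fin m, t k.succ = S k.succ / S k.castSucc := fun k => rfl
  have hP : ∀ k, prefixProd t k = S k := fun k => by
    induction k using Fin.induction with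
    | zero => rw [prefixProd_zero, ht0]
    | succ k ih => rw [prefixProd_succ, ih, htsucc, mul_div_cancel₀ _ (hSpos _).ne']
  refine ⟨t, fun k => ?_, by rw [ht0, hS0], fun k => ?_⟩
  · cases k using Fin.cases with
    | zero => exact ⟨hSpos 0, by rw [ht0, hS0]; exact hs⟩
    | succ k =>
      refine ⟨div_pos (hSpos _) (hSpos _), ?_⟩
      rw [htsucc, div_lt_one (hSpos _), hSsucc]
      linarith [hz k.castSucc]
  · cases k using Fin.lastCases with
    | last => rw [stickCoeff_last, hP, hSlast]
    | cast k => rw [stickCoeff_castSucc_succ, hP, hP, hSsucc]; ring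

/-- Coordinates of the cone over the face parametrized by `stickCoeff`, the apex direction being
scaled by `v 0`. -/
noncomputable def coneCoord (m : ℕ) (v : Fin (m + 2) → ℝ) (j : Fin (m + 2)) : ℝ :=
  (if j = 0 then v 0 else 1) * stickCoeff (m + 2) (Fin.tail v) j

/-- Tail sums of `coneCoord`. -/
noncomputable def coneTail (m : ℕ) (v : Fin (m + 2) → ℝ) : Fin (m + 2) → ℝ :=
  Fin.cons (v 0 * (1 - v 1)) (prefixProd (Fin.tail v))

/-- The unipotent matrix recovering coordinates from their tail sums. -/
def tailDiffMatrix (m : ℕ) : Matrix (Fin (m + 2)) (Fin (m + 2)) ℝ :=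
  Matrix.of fun a b => if a = b then 1 else if a ≠ 0 ∧ (b : ℕ) = a + 1 then -1 else 0

/-- The Jacobian matrix of `coneTail`. -/
noncomputable def coneTailJacobian (m : ℕ) (v : Fin (m + 2) → ℝ) :
    Matrix (Fin (m + 2)) (Fin (m + 2)) ℝ :=
  Matrix.of (Fin.cons (Fin.cons (1 - v 1) (Fin.cons (- v 0) 0)) fun j : Fin (m + 1) =>
    Fin.cons 0 fun k => if k ≤ j then ∏ l ∈ (Finset.Iic j).erase k, v l.succ else 0)

lemma det_tailDiffMatrix (m : ℕ) : (tailDiffMatrix m).det = 1 := by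
  rw [Matrix.det_of_isUpperTriangular]
  · simp [tailDiffMatrix]
  · intro a b hab
    have : b < a := hab
    have h1 : a ≠ b := this.ne'
    have h2 : ¬ ((b : ℕ) = a + 1) := by
      have := Fin.lt_def.1 this
      omega
    simp [tailDiffMatrix, h1, h2]

lemma det_coneTailJacobian (m : ℕ) (v : Fin (m + 2) → ℝ) :
    (coneTailJacobian m v).det = (1 - v 1) * psiMap (m + 2) (Fin.tail v) := by
  rw [Matrix.det_succ_column_zero, Fin.sum_univ_succ]
  have h0 : ∀ j : Fin (m + 1), coneTailJacobian m v j.succ 0 = 0 := fun j => rfl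
  have h00 : coneTailJacobian m v 0 0 = 1 - v 1 := rfl
  simp only [h0, h00, mul_zero, zero_mul, Finset.sum_const_zero, add_zero, Fin.val_zero, pow_zero,
    one_mul]
  congr 1
  rw [Matrix.det_of_isLowerTriangular, ← prod_prod_Iio_eq_psiMap]
  · refine Finset.prod_congr rfl fun k _ => ?_
    have hk : (Finset.Iic k).erase k = Finset.Iio k := by
      ext l
      simp [lt_iff_le_and_ne, and_comm]
    simp [coneTailJacobian, hk, Fin.tail]
  · intro a b hab
    have h : ¬ b ≤ a := not_le.2 hab
    simp [coneTailJacobian, h]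

lemma tailDiffMatrix_mulVec_coneTail (m : ℕ) (v : Fin (m + 2) → ℝ) :
    (tailDiffMatrix m).mulVec (coneTail m v) = coneCoord m v := by
  have hsum : ∀ (j : Fin (m + 2)) (u : Fin (m + 2) → ℝ), (tailDiffMatrix m).mulVec u j =
      u j - ∑ b : Fin (m + 2), if j ≠ 0 ∧ (b : ℕ) = j + 1 then u b else 0 := fun j u => by
    have hu : u j = ∑ b : Fin (m + 2), if j = b then u b else 0 := by simp
    rw [hu, ← Finset.sum_sub_distrib, Matrix.mulVec, dotProduct]
    refine Finset.sum_congr rfl fun b _ => ?_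
    by_cases hjb : j = b
    · subst hjb; simp [tailDiffMatrix]
    · by_cases h : j ≠ 0 ∧ (b : ℕ) = j + 1 <;> simp [tailDiffMatrix, hjb, h]
  funext j
  rw [hsum, coneCoord]
  cases j using Fin.cases with
  | zero => simp [coneTail, stickCoeff_zero, Fin.tail]
  | succ j =>
    cases j using Fin.lastCases with
    | last =>
      rw [stickCoeff_last, Finset.sum_eq_zero]
      · simp [coneTail]
      · intro b _
        rw [if_neg]
        rintro ⟨-, h⟩
        have := b.2
        simp at h
        omega
    | cast j =>
      rw [stickCoeff_castSucc_succ, Finset.sum_eq_single j.succ.succ]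
      · simp [coneTail]
      · intro b _ hb
        rw [if_neg]
        rintro ⟨-, h⟩
        exact hb (Fin.ext (by simpa using h))
      · simp

lemma hasFDerivAt_coneTail (m : ℕ) (v : Fin (m + 2) → ℝ) :
    HasFDerivAt (coneTail m) (Matrix.toLin' (coneTailJacobian m v)).toContinuousLinearMap v := by
  have hproj : ∀ k : Fin (m + 2), HasFDerivAt (fun w : Fin (m + 2) → ℝ => w k)
      (ContinuousLinearMap.proj (R := ℝ) (φ := fun _ => ℝ) k) v := fun k => hasFDerivAt_apply k v
  rw [hasFDerivAt_pi']
  intro j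
  cases j using Fin.cases with
  | zero =>
    refine ((hproj 0).mul ((hproj 1).const_sub 1)).congr_fderiv ?_
    ext w
    simp [coneTailJacobian, Matrix.mulVec, dotProduct, Fin.sum_univ_succ]
    ring
  | succ j =>
    refine (HasFDerivAt.finsetProd (u := Finset.Iic j) fun k _ => hproj k.succ).congr_fderiv ?_
    ext w
    simp [coneTailJacobian, Matrix.mulVec, dotProduct, Fin.sum_univ_succ (n := m + 1)]
    rw [← Finset.sum_filter]
    exact Finset.sum_congr (by ext; simp) fun _ _ => rfl

lemma hasFDerivAt_coneCoord (m : ℕ) (v : Fin (m + 2) → ℝ) :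
    HasFDerivAt (coneCoord m)
      (Matrix.toLin' (tailDiffMatrix m * coneTailJacobian m v)).toContinuousLinearMap v := by
  have h : coneCoord m = (Matrix.toLin' (tailDiffMatrix m)).toContinuousLinearMap ∘ coneTail m :=
    funext fun w => (tailDiffMatrix_mulVec_coneTail m w).symm
  rw [h]
  refine ((ContinuousLinearMap.hasFDerivAt _).comp v (hasFDerivAt_coneTail m v)).congr_fderiv ?_
  ext w
  simp [Matrix.toLin'_mul]

lemma continuous_coneCoord (m : ℕ) : Continuous (coneCoord m) :=
  continuous_iff_continuousAt.2 fun v => (hasFDerivAt_coneCoord m v).continuousAt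

/-- The product of the unit cube with the interval `(0, c)`. -/
def coneBox (m : ℕ) (c : ℝ) : Set (Fin (m + 2) → ℝ) :=
  {v | v 0 ∈ Set.Ioo 0 c ∧ ∀ k : Fin (m + 1), v k.succ ∈ Set.Ioo (0 : ℝ) 1}

/-- The interior of the standard corner simplex whose `0`-th vertex is scaled by `c`. -/
def openCorner (m : ℕ) (c : ℝ) : Set (Fin (m + 2) → ℝ) :=
  {z | (∀ j, 0 < z j) ∧ z 0 / c + ∑ k : Fin (m + 1), z k.succ < 1}

/-- The standard corner simplex whose `0`-th vertex is scaled by `c`. -/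
def closedCorner (m : ℕ) (c : ℝ) : Set (Fin (m + 2) → ℝ) :=
  {z | (∀ j, 0 ≤ z j) ∧ z 0 / c + ∑ k : Fin (m + 1), z k.succ ≤ 1}

lemma measurableSet_coneBox (m : ℕ) (c : ℝ) : MeasurableSet (coneBox m c) := by
  have : coneBox m c = (fun v => v 0) ⁻¹' Set.Ioo 0 c ∩
      ⋂ k : Fin (m + 1), (fun v => v k.succ) ⁻¹' Set.Ioo (0 : ℝ) 1 := by
    ext v
    simp [coneBox]
  rw [this]
  exact (measurable_pi_apply _ measurableSet_Ioo).inter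
    (MeasurableSet.iInter fun k => measurable_pi_apply _ measurableSet_Ioo)

lemma injOn_coneCoord (m : ℕ) (c : ℝ) : Set.InjOn (coneCoord m) (coneBox m c) := by
  intro v hv w hw h
  rw [← tailDiffMatrix_mulVec_coneTail, ← tailDiffMatrix_mulVec_coneTail] at h
  have hT : coneTail m v = coneTail m w :=
    Matrix.mulVec_injective_of_isUnit
      ((Matrix.isUnit_iff_isUnit_det _).2 (by simp [det_tailDiffMatrix])) h
  have ht : ∀ k : Fin (m + 1), v k.succ = w k.succ :=
    eq_of_prefixProd_eq (t := Fin.tail v) (t' := Fin.tail w) (fun k => (hv.2 k).1)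
      fun k => congrFun hT k.succ
  have h0 : v 0 * (1 - v 1) = w 0 * (1 - w 1) := congrFun hT 0
  have h1 : v 1 = w 1 := ht 0
  have h2 : 0 < 1 - w 1 := sub_pos.2 (hw.2 0).2
  rw [h1] at h0
  funext j
  cases j using Fin.cases with
  | zero => exact mul_right_cancel₀ h2.ne' h0
  | succ j => exact ht j

lemma image_coneCoord (m : ℕ) {c : ℝ} (hc : 0 < c) :
    coneCoord m '' coneBox m c = openCorner m c := by
  apply Set.Subset.antisymm
  · rintro _ ⟨v, hv, rfl⟩
    have hpos := stickCoeff_pos (d := m + 2) (t := Fin.tail v) hv.2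
    refine ⟨fun j => mul_pos ?_ (hpos j), ?_⟩
    · split_ifs
      exacts [hv.1.1, one_pos]
    · have hs : ∑ k : Fin (m + 1), coneCoord m v k.succ = Fin.tail v 0 := by
        simpa [coneCoord] using sum_stickCoeff_succ m (Fin.tail v)
      have h1 : 0 < 1 - v 1 := sub_pos.2 (hv.2 0).2
      have h0 : coneCoord m v 0 = v 0 * (1 - v 1) := by
        simp [coneCoord, stickCoeff_zero, Fin.tail]
      have h2 : v 0 / c < 1 := (div_lt_one hc).2 hv.1.2
      rw [hs, h0, mul_div_right_comm, show Fin.tail v 0 = v 1 from rfl]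
      nlinarith
  · rintro z ⟨hz, hs⟩
    have hz0 : 0 < z 0 / c := div_pos (hz 0) hc
    obtain ⟨t, ht, ht0, htz⟩ :=
      exists_stickCoeff_succ_eq m (z := fun k => z k.succ) (fun k => hz _) (by linarith)
    have h1 : 0 < 1 - t 0 := sub_pos.2 (ht 0).2
    refine ⟨Fin.cons (z 0 / (1 - t 0)) t, ⟨⟨div_pos (hz 0) h1, ?_⟩, ht⟩, ?_⟩
    · rw [Fin.cons_zero, div_lt_iff₀ h1, mul_comm, ← div_lt_iff₀ hc]
      linarith
    · funext j
      cases j using Fin.cases with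
      | zero => simp [coneCoord, stickCoeff_zero, h1.ne']
      | succ j => simpa [coneCoord] using htz j

lemma convex_closedCorner (m : ℕ) (c : ℝ) : Convex ℝ (closedCorner m c) := by
  rintro x ⟨hx, hx'⟩ y ⟨hy, hy'⟩ a b ha hb hab
  refine ⟨fun j => add_nonneg (mul_nonneg ha (hx j)) (mul_nonneg hb (hy j)), ?_⟩
  simp only [Pi.add_apply, Pi.smul_apply, smul_eq_mul, Finset.sum_add_distrib, ← Finset.mul_sum]
  calc _ = a * (x 0 / c + ∑ k : Fin (m + 1), x k.succ) +
        b * (y 0 / c + ∑ k : Fin (m + 1), y k.succ) := by ring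
    _ ≤ a * 1 + b * 1 := by gcongr
    _ = 1 := by linarith

lemma isClosed_closedCorner (m : ℕ) (c : ℝ) : IsClosed (closedCorner m c) := by
  have : closedCorner m c = (⋂ j, {z | 0 ≤ z j}) ∩
      {z | z 0 / c + ∑ k : Fin (m + 1), z k.succ ≤ 1} := by
    ext z
    simp [closedCorner]
  rw [this]
  exact (isClosed_iInter fun j => isClosed_le (by fun_prop) (by fun_prop)).inter
    (isClosed_le (by fun_prop) (by fun_prop))

lemma interior_closedCorner_subset (m : ℕ) {c : ℝ} (hc : 0 < c) :
    interior (closedCorner m c) ⊆ openCorner m c := by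
  intro x hx
  have key : ∀ e : Fin (m + 2) → ℝ, ∃ ε : ℝ, 0 < ε ∧ x + ε • e ∈ closedCorner m c := fun e => by
    have hcont : Filter.Tendsto (fun s : ℝ => x + s • e) (nhds 0) (nhds x) := by
      have : Continuous fun s : ℝ => x + s • e := by fun_prop
      simpa using this.tendsto 0
    have hev := (hcont.eventually (mem_interior_iff_mem_nhds.1 hx)).filter_mono
      (nhdsWithin_le_nhds (s := Set.Ioi 0))
    obtain ⟨ε, h, hε⟩ := (hev.and self_mem_nhdsWithin).exists
    exact ⟨ε, hε, h⟩
  refine ⟨fun j => ?_, ?_⟩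
  · obtain ⟨ε, hε, h⟩ := key (-Pi.single j 1)
    have := h.1 j
    simp at this
    linarith
  · obtain ⟨ε, hε, h⟩ := key (Pi.single 0 1)
    have := h.2
    simp [add_div] at this
    have := div_pos hε hc
    linarith

lemma openCorner_ae_eq_closedCorner (m : ℕ) {c : ℝ} (hc : 0 < c) :
    openCorner m c =ᵐ[volume] closedCorner m c := by
  have hsub : openCorner m c ⊆ closedCorner m c := fun z hz => ⟨fun j => (hz.1 j).le, hz.2.le⟩
  refine hsub.eventuallyLE.antisymm (ae_le_set.2 (measure_mono_null ?_
    ((convex_closedCorner m c).addHaar_frontier volume)))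
  rintro z ⟨hz, hz'⟩
  exact ⟨subset_closure hz, fun h => hz' (interior_closedCorner_subset m hc h)⟩

lemma setIntegral_closedCorner (m : ℕ) {c : ℝ} (hc : 0 < c) (f : (Fin (m + 2) → ℝ) → ℝ) :
    ∫ z in closedCorner m c, f z =
      ∫ v in coneBox m c, f (coneCoord m v) * ((1 - v 1) * psiMap (m + 2) (Fin.tail v)) := by
  rw [← setIntegral_congr_set (openCorner_ae_eq_closedCorner m hc), ← image_coneCoord m hc,
    integral_image_eq_integral_abs_det_fderiv_smul volume (measurableSet_coneBox m c)
      (fun v _ => (hasFDerivAt_coneCoord m v).hasFDerivWithinAt) (injOn_coneCoord m c)]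
  refine setIntegral_congr_fun (measurableSet_coneBox m c) fun v hv => ?_
  have hdet : (Matrix.toLin' (tailDiffMatrix m * coneTailJacobian m v)).toContinuousLinearMap.det =
      (1 - v 1) * psiMap (m + 2) (Fin.tail v) := by
    rw [LinearMap.det_toContinuousLinearMap, LinearMap.det_toLin', Matrix.det_mul,
      det_tailDiffMatrix, det_coneTailJacobian, one_mul]
  have hnn : 0 ≤ (1 - v 1) * psiMap (m + 2) (Fin.tail v) :=
    mul_nonneg (sub_nonneg.2 (hv.2 0).2.le) (psiMap_nonneg (d := m + 2) fun k => (hv.2 k).1.le)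
  simp only [hdet, abs_of_nonneg hnn, smul_eq_mul, mul_comm]

lemma continuous_finCons {n : ℕ} : Continuous fun q : ℝ × (Fin n → ℝ) =>
    (Fin.cons q.1 q.2 : Fin (n + 1) → ℝ) := by
  refine continuous_pi fun j => ?_
  cases j using Fin.cases with
  | zero => exact continuous_fst
  | succ j => exact (continuous_apply j).comp continuous_snd

lemma setIntegral_coneBox (m : ℕ) {c : ℝ} (hc : 0 < c) {f : (Fin (m + 2) → ℝ) → ℝ}
    (hf : Continuous f) :
    ∫ v in coneBox m c, f v = ∫ u in (0)..c,
      ∫ t in Set.univ.pi fun _ : Fin (m + 1) => Set.Ioo (0 : ℝ) 1, f (Fin.cons u t) := by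
  let e := MeasurableEquiv.piFinSuccAbove (fun _ : Fin (m + 2) => ℝ) 0
  have he : MeasurePreserving e volume volume :=
    volume_preserving_piFinSuccAbove (fun _ : Fin (m + 2) => ℝ) 0
  have hpre : coneBox m c = e ⁻¹' (Set.Ioo 0 c ×ˢ
      Set.univ.pi fun _ : Fin (m + 1) => Set.Ioo (0 : ℝ) 1) := by
    ext v
    simp [coneBox, e, MeasurableEquiv.piFinSuccAbove, Fin.tail]
  have hfe : ∀ v, f v = f (Fin.cons (e v).1 (e v).2) := fun v => by
    rw [show (e v).1 = v 0 from rfl, show (e v).2 = Fin.tail v from rfl, Fin.cons_self_tail]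
  rw [hpre, integral_congr_ae (Filter.Eventually.of_forall hfe),
    he.setIntegral_preimage_emb e.measurableEmbedding
    (fun q : ℝ × (Fin (m + 1) → ℝ) => f (Fin.cons q.1 q.2))]
  rw [Measure.volume_eq_prod, setIntegral_prod, intervalIntegral.integral_of_le hc.le,
    integral_Ioc_eq_integral_Ioo]
  · refine ((hf.comp continuous_finCons).continuousOn.integrableOn_compact
      (isCompact_Icc.prod isCompact_Icc) (K := Set.Icc (0 : ℝ) c ×ˢ
        Set.Icc (0 : Fin (m + 1) → ℝ) 1)).mono_set (Set.prod_mono Set.Ioo_subset_Icc_self ?_)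
    exact fun t ht => ⟨fun k => (ht k trivial).1.le, fun k => (ht k trivial).2.le⟩

lemma convexHull_insert_zero_range_update {E : Type*} [AddCommGroup E] [Module ℝ E] (m : ℕ)
    (p : Fin (m + 2) → E) {c : ℝ} (hc : 0 < c) :
    convexHull ℝ (insert 0 (Set.range (Function.update p 0 (c • p 0)))) =
      Fintype.linearCombination ℝ p '' closedCorner m c := by
  apply Set.Subset.antisymm
  · refine convexHull_min ?_ ((convex_closedCorner m c).linear_image _)
    rintro _ (rfl | ⟨j, rfl⟩)
    · exact ⟨0, ⟨fun j => le_rfl, by simp⟩, by simp⟩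
    · cases j using Fin.cases with
      | zero =>
        refine ⟨Pi.single 0 c, ⟨fun j => ?_, ?_⟩, ?_⟩
        · exact (Pi.single_nonneg.2 hc.le : (0 : Fin (m + 2) → ℝ) ≤ _) j
        · simp [hc.ne']
        · simp [Fintype.linearCombination_apply_single]
      | succ k =>
        refine ⟨Pi.single k.succ 1, ⟨fun j => ?_, ?_⟩, ?_⟩
        · exact (Pi.single_nonneg.2 zero_le_one : (0 : Fin (m + 2) → ℝ) ≤ _) j
        · simp [Pi.single_apply]
        · simp [Fintype.linearCombination_apply_single]
  · rintro _ ⟨z, ⟨hz, hs⟩, rfl⟩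
    set S := insert 0 (Set.range (Function.update p 0 (c • p 0)))
    let w : Option (Fin (m + 2)) → ℝ := fun o =>
      o.elim (1 - (z 0 / c + ∑ k : Fin (m + 1), z k.succ)) (Fin.cons (z 0 / c) fun k => z k.succ)
    let x : Option (Fin (m + 2)) → E := fun o => o.elim 0 (Function.update p 0 (c • p 0))
    have hx : ∑ o, w o • x o = Fintype.linearCombination ℝ p z := by
      simp [w, x, Fintype.sum_option, Fintype.linearCombination_apply,
        Fin.sum_univ_succ (n := m + 1), smul_smul, hc.ne']
    rw [← hx]
    refine (convex_convexHull ℝ S).sum_mem (fun o _ => ?_) ?_ fun o _ => subset_convexHull ℝ S ?_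
    · rcases o with _ | j
      · exact sub_nonneg.2 hs
      · cases j using Fin.cases with
        | zero => exact div_nonneg (hz 0) hc.le
        | succ k => exact hz k.succ
    · simp [w, Fintype.sum_option, Fin.sum_univ_succ (n := m + 1)]
    · rcases o with _ | j
      · exact Set.mem_insert _ _
      · exact Set.mem_insert_of_mem _ ⟨j, rfl⟩

lemma setIntegral_linearCombination_image {ι : Type*} [Fintype ι] [DecidableEq ι]
    {p : ι → EuclideanSpace ℝ ι} (hp : LinearIndependent ℝ p) {K : Set (ι → ℝ)}
    (hK : MeasurableSet K) (g : EuclideanSpace ℝ ι → ℝ) :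
    ∫ x in Fintype.linearCombination ℝ p '' K, g x =
      |(Matrix.of fun a b => p b a).det| *
        ∫ z in K, g (Fintype.linearCombination ℝ p z) := by
  set A : Matrix ι ι ℝ := Matrix.of fun a b => p b a
  have hA : ∀ z, WithLp.toLp 2 (Matrix.toLin' A z) = Fintype.linearCombination ℝ p z := fun z => by
    ext a
    simp [A, Fintype.linearCombination_apply, Matrix.mulVec, dotProduct, mul_comm]
  have hinj : Function.Injective (Matrix.toLin' A) := fun x y h =>
    hp.fintypeLinearCombination_injective (by rw [← hA, ← hA, h])
  have hpre : WithLp.toLp 2 ⁻¹' (Fintype.linearCombination ℝ p '' K) =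
      (Matrix.toLin' A).toContinuousLinearMap '' K := by
    ext y
    constructor
    · rintro ⟨z, hz, h⟩
      refine ⟨z, hz, ?_⟩
      rw [← hA] at h
      exact (WithLp.toLp_injective 2) h
    · rintro ⟨z, hz, rfl⟩
      exact ⟨z, hz, (hA z).symm⟩
  rw [← (PiLp.volume_preserving_toLp ι).setIntegral_preimage_emb
    (MeasurableEquiv.toLp 2 (ι → ℝ)).measurableEmbedding, hpre,
    integral_image_eq_integral_abs_det_fderiv_smul volume hK
      (fun z _ => (ContinuousLinearMap.hasFDerivAt _).hasFDerivWithinAt) hinj.injOn]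
  simp only [LinearMap.det_toContinuousLinearMap, LinearMap.det_toLin', smul_eq_mul,
    LinearMap.coe_toContinuousLinearMap', hA, integral_const_mul]

lemma abs_det_comp_perm {ι : Type*} [Fintype ι] [DecidableEq ι] (p : ι → EuclideanSpace ℝ ι)
    (σ : Equiv.Perm ι) :
    |(Matrix.of fun a b => (p ∘ σ) b a).det| = |(Matrix.of fun a b => p b a).det| := by
  have h : (Matrix.of fun a b => (p ∘ σ) b a) =
      (Matrix.of fun a b => p b a).submatrix id σ := rfl
  rw [h, Matrix.det_permute', abs_mul]
  rcases Int.units_eq_one_or (Equiv.Perm.sign σ) with hσ | hσ <;> simp [hσ]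

lemma linearCombination_coneCoord_cons {E : Type*} [AddCommGroup E] [Module ℝ E] (m : ℕ)
    (p : Fin (m + 2) → E) (t : Fin (m + 1) → ℝ) :
    Fintype.linearCombination ℝ p (coneCoord m (Fin.cons 1 t)) = etaMap p t := by
  simp [Fintype.linearCombination_apply, coneCoord, etaMap]

/-- differentiating the simplex integral `∫_{S(s)} g` in the scaling
parameter `s` of the `i`-th vertex gives
`(1/r_i)|det P| ∫_{(0,1)^{d-1}} g(η_i(t)) ψ̂(t) dt`, where `η_i` is `η` with `p_1`
and `p_i` swapped and `ψ̂(t) = (1 - t_1) ψ(t)`. -/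
theorem hasDerivAt_simplex_integral_vertex_scaling (d : ℕ) (hd : 2 ≤ d)
    (q : Fin d → EuclideanSpace ℝ (Fin d)) (hq : ∀ j, ‖q j‖ = 1)
    (r : Fin d → ℝ) (hr : ∀ j, 0 < r j)
    (p : Fin d → EuclideanSpace ℝ (Fin d)) (hp : ∀ j, p j = r j • q j)
    (hind : LinearIndependent ℝ p) (i : Fin d)
    (g : EuclideanSpace ℝ (Fin d) → ℝ) (hg : Continuous g) :
    HasDerivAt
      (fun s : ℝ =>
        ∫ x in convexHull ℝ
            (insert (0 : EuclideanSpace ℝ (Fin d))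
              (Set.range (Function.update p i (s • q i)))), g x)
      ((1 / r i) * |Matrix.det (Matrix.of fun a b => p b a)| *
        ∫ t in (Set.univ.pi fun _ : Fin (d - 1) => Set.Ioo (0 : ℝ) 1),
          g (etaMap (p ∘ Equiv.swap ⟨0, by omega⟩ i) t) *
            ((1 - t ⟨0, by omega⟩) * psiMap d t))
      (r i) := by
  obtain ⟨m, rfl⟩ : ∃ m, d = m + 2 := ⟨d - 2, by omega⟩
  set σ : Equiv.Perm (Fin (m + 2)) := Equiv.swap 0 i with hσ
  set D := |Matrix.det (Matrix.of fun a b => p b a)| with hD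
  have hp0 : (p ∘ σ) 0 = p i := by simp [hσ]
  have hpσ : LinearIndependent ℝ (p ∘ σ) := hind.comp _ σ.injective
  let L := Fintype.linearCombination ℝ (p ∘ σ)
  let f : (Fin (m + 2) → ℝ) → ℝ := fun v =>
    g (L (coneCoord m v)) * ((1 - v 1) * psiMap (m + 2) (Fin.tail v))
  have hL : Continuous L := L.continuous_of_finiteDimensional
  have hψ : Continuous fun v : Fin (m + 2) → ℝ => psiMap (m + 2) (Fin.tail v) :=
    (continuous_psiMap (m + 2)).comp (continuous_pi fun k => continuous_apply k.succ)
  have hf : Continuous f := by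
    refine (hg.comp (hL.comp (continuous_coneCoord m))).mul (Continuous.mul ?_ hψ)
    fun_prop
  let G : ℝ → ℝ := fun u =>
    ∫ t in Set.univ.pi fun _ : Fin (m + 1) => Set.Ioo (0 : ℝ) 1, f (Fin.cons u t)
  have hG : Continuous G := by
    have hGI : G = fun u => ∫ t in Set.Icc (0 : Fin (m + 1) → ℝ) 1, f (Fin.cons u t) :=
      funext fun u => setIntegral_congr_set Measure.univ_pi_Ioo_ae_eq_Icc
    rw [hGI]
    exact continuous_parametric_integral_of_continuous (f := fun u t => f (Fin.cons u t))
      (hf.comp continuous_finCons) isCompact_Icc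
  have hF : ∀ s : ℝ, 0 < s → ∫ x in convexHull ℝ (insert (0 : EuclideanSpace ℝ (Fin (m + 2)))
      (Set.range (Function.update p i (s • q i)))), g x = D * ∫ u in (0)..(s / r i), G u := by
    intro s hs
    have hc : 0 < s / r i := div_pos hs (hr i)
    have hrange : Set.range (Function.update p i (s • q i)) =
        Set.range (Function.update (p ∘ σ) 0 ((s / r i) • (p ∘ σ) 0)) := by
      have hsq : s • q i = (s / r i) • (p ∘ σ) 0 := by
        rw [hp0, hp i, smul_smul, div_mul_cancel₀ _ (hr i).ne']
      have hup : Function.update (p ∘ σ) 0 (s • q i) = Function.update p i (s • q i) ∘ σ := by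
        rw [Function.update_comp_equiv]
        simp [hσ]
      rw [← hsq, hup, EquivLike.range_comp]
    rw [hrange, convexHull_insert_zero_range_update m (p ∘ σ) hc,
      setIntegral_linearCombination_image hpσ (isClosed_closedCorner m _).measurableSet,
      abs_det_comp_perm, setIntegral_closedCorner m hc, setIntegral_coneBox m hc hf]
  have hGD : HasDerivAt (fun s : ℝ => D * ∫ u in (0)..(s / r i), G u)
      (D * (G (r i / r i) * (1 / r i))) (r i) :=
    ((hG.integral_hasStrictDerivAt 0 _).hasDerivAt.comp (r i)
      ((hasDerivAt_id (r i)).div_const (r i))).const_mul D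
  have hval : (1 / r i) * D * G 1 = D * (G (r i / r i) * (1 / r i)) := by
    rw [div_self (hr i).ne']
    ring
  have hG1 : G 1 = ∫ t in (Set.univ.pi fun _ : Fin (m + 2 - 1) => Set.Ioo (0 : ℝ) 1),
      g (etaMap (p ∘ Equiv.swap ⟨0, by omega⟩ i) t) *
        ((1 - t ⟨0, by omega⟩) * psiMap (m + 2) t) := by
    simp only [G, f, L, linearCombination_coneCoord_cons]
    rfl
  rw [← hG1, hval]
  refine hGD.congr_of_eventuallyEq ?_
  filter_upwards [lt_mem_nhds (hr i)] with s hs using hF s hs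
end

section
/- Let 0 < r_min ≤ r_max < ∞, let r : ℝ → [r_min, r_max] be twice continuously differentiable and 2π-periodic, let p(θ) := (cos θ, sin θ), and let D := { s·p(θ) : θ ∈ [0,2π), 0 ≤ s < r(θ) } ⊂ ℝ². For N ≥ 4 let D̃_N be the polygon with vertices p_i := r(2πi/N) p(2πi/N), i = 1,…,N, i.e. D̃_N = ⋃_{i=1}^N conv{0, p_i, p_{i+1}} with p_{N+1} := p_1. Let V : ℝ² → ℝ be continuously differentiable, ρ̃ := e^{−V}, let f : ℝ² → [0,∞) be continuous and κ > 0, and define for a bounded domain E with rectifiable boundary J(E) := ( ∫_E f ρ̃ dx + κ ∫_{∂E} ρ̃ dH^1 ) / ∫_E ρ̃ dx, where H^1 is 1-dimensional Hausdorff measure. Then there exists a constant K ≥ 0 such that for all N ≥ 4, |J(D) − J(D̃_N)| ≤ K/N. -/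
open MeasureTheory Real

/-- The unit vector `p(θ) = (cos θ, sin θ)` in the Euclidean plane. -/
noncomputable def pvec (θ : ℝ) : EuclideanSpace ℝ (Fin 2) :=
  (EuclideanSpace.equiv (Fin 2) ℝ).symm ![Real.cos θ, Real.sin θ]

/-- The star-shaped domain `D = {s·p(θ) : θ ∈ [0,2π), 0 ≤ s < r(θ)}`. -/
def starDomain (r : ℝ → ℝ) : Set (EuclideanSpace ℝ (Fin 2)) :=
  {x | ∃ θ ∈ Set.Ico (0 : ℝ) (2 * π), ∃ s ∈ Set.Ico (0 : ℝ) (r θ), x = s • pvec θ}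

/-- The vertex `p_i = r(2πi/N) p(2πi/N)` of the inscribed polygon. -/
noncomputable def starVertex (r : ℝ → ℝ) (N i : ℕ) : EuclideanSpace ℝ (Fin 2) :=
  r (2 * π * i / N) • pvec (2 * π * i / N)

/-- The inscribed star-shaped polygon `D̃_N = ⋃ᵢ conv{0, pᵢ, pᵢ₊₁}`. -/
noncomputable def starPolygon (r : ℝ → ℝ) (N : ℕ) : Set (EuclideanSpace ℝ (Fin 2)) :=
  ⋃ i ∈ Finset.range N, convexHull ℝ {0, starVertex r N i, starVertex r N (i + 1)}

/-- The shape functional `J(E) = (∫_E f e^{-V} dx + κ ∫_{∂E} e^{-V} dH¹)/∫_E e^{-V} dx`. -/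
noncomputable def shapeJ (V : EuclideanSpace ℝ (Fin 2) → ℝ)
    (f : EuclideanSpace ℝ (Fin 2) → ℝ) (κ : ℝ) (E : Set (EuclideanSpace ℝ (Fin 2))) : ℝ :=
  ((∫ x in E, f x * Real.exp (-V x)) +
      κ * ∫ x in frontier E, Real.exp (-V x) ∂(μH[(1 : ℝ)])) /
    ∫ x in E, Real.exp (-V x)

lemma pvec_apply_zero (θ : ℝ) : pvec θ 0 = Real.cos θ := rfl

lemma pvec_apply_one (θ : ℝ) : pvec θ 1 = Real.sin θ := rfl

lemma norm_pvec (θ : ℝ) : ‖pvec θ‖ = 1 := by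
  rw [EuclideanSpace.norm_eq, Fin.sum_univ_two, pvec_apply_zero, pvec_apply_one]
  simp

lemma norm_smul_pvec {s : ℝ} (hs : 0 ≤ s) (θ : ℝ) : ‖s • pvec θ‖ = s := by
  rw [norm_smul, norm_pvec, mul_one, Real.norm_of_nonneg hs]

lemma contDiff_pvec : ContDiff ℝ 2 pvec := by
  unfold pvec
  refine (EuclideanSpace.equiv (Fin 2) ℝ).symm.contDiff.comp ?_
  rw [contDiff_pi]
  intro i
  fin_cases i
  · exact Real.contDiff_cos
  · exact Real.contDiff_sin

lemma continuous_pvec : Continuous pvec := contDiff_pvec.continuous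

lemma pvec_periodic : Function.Periodic pvec (2 * π) := by
  intro θ
  simp [pvec]

lemma apply_eq_of_pvec_eq {R : ℝ → ℝ} (hper : Function.Periodic R (2 * π)) {θ φ : ℝ}
    (h : pvec θ = pvec φ) : R θ = R φ := by
  have hc : Real.cos θ = Real.cos φ := congrArg (fun x => x 0) h
  have hs : Real.sin θ = Real.sin φ := congrArg (fun x => x 1) h
  obtain ⟨k, hk⟩ := Real.Angle.angle_eq_iff_two_pi_dvd_sub.1 (Real.Angle.cos_sin_inj hc hs)
  have : θ = φ + k * (2 * π) := by linarith
  rw [this]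
  exact hper.int_mul k φ

lemma exists_eq_norm_smul_pvec (x : EuclideanSpace ℝ (Fin 2)) : ∃ θ, x = ‖x‖ • pvec θ := by
  refine ⟨Complex.arg ⟨x 0, x 1⟩, ?_⟩
  have hn : ‖x‖ = ‖(⟨x 0, x 1⟩ : ℂ)‖ := by
    rw [EuclideanSpace.norm_eq, Fin.sum_univ_two, Complex.norm_eq_sqrt_sq_add_sq]
    simp
  rw [hn]
  ext i
  fin_cases i
  · exact (Complex.norm_mul_cos_arg ⟨x 0, x 1⟩).symm
  · exact (Complex.norm_mul_sin_arg ⟨x 0, x 1⟩).symm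

lemma exists_mem_Ico_smul_pvec_eq (θ : ℝ) : ∃ φ ∈ Set.Ico (0 : ℝ) (2 * π), pvec θ = pvec φ := by
  obtain ⟨φ, hφ, h⟩ := pvec_periodic.exists_mem_Ico₀ Real.two_pi_pos θ
  exact ⟨φ, hφ, h⟩

/-- The closed star-shaped body with radial function `R`. -/
def closedStar (R : ℝ → ℝ) : Set (EuclideanSpace ℝ (Fin 2)) :=
  {x | ∃ θ ∈ Set.Ico (0 : ℝ) (2 * π), ∃ s ∈ Set.Icc (0 : ℝ) (R θ), x = s • pvec θ}

section Star

variable {R : ℝ → ℝ}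

lemma smul_pvec_inj (hper : Function.Periodic R (2 * π)) {s t θ φ : ℝ} (hs : 0 < s) (ht : 0 ≤ t)
    (h : s • pvec θ = t • pvec φ) : s = t ∧ R θ = R φ := by
  have hst : s = t := by
    rw [← norm_smul_pvec hs.le θ, h, norm_smul_pvec ht]
  subst hst
  exact ⟨rfl, apply_eq_of_pvec_eq hper (smul_right_injective _ hs.ne' h)⟩

lemma smul_pvec_mem_starDomain (hper : Function.Periodic R (2 * π)) (hpos : ∀ θ, 0 < R θ)
    {s : ℝ} (hs : 0 ≤ s) (θ : ℝ) : s • pvec θ ∈ starDomain R ↔ s < R θ := by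
  constructor
  · rintro ⟨φ, -, t, ht, h⟩
    rcases hs.eq_or_lt with rfl | hs
    · exact hpos θ
    · obtain ⟨rfl, h'⟩ := smul_pvec_inj hper hs ht.1 h
      rw [h']
      exact ht.2
  · intro h
    obtain ⟨φ, hφ, e⟩ := exists_mem_Ico_smul_pvec_eq θ
    exact ⟨φ, hφ, s, ⟨hs, by rwa [← apply_eq_of_pvec_eq hper e]⟩, by rw [e]⟩

lemma smul_pvec_mem_closedStar (hper : Function.Periodic R (2 * π)) (hpos : ∀ θ, 0 < R θ)
    {s : ℝ} (hs : 0 ≤ s) (θ : ℝ) : s • pvec θ ∈ closedStar R ↔ s ≤ R θ := by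
  constructor
  · rintro ⟨φ, -, t, ht, h⟩
    rcases hs.eq_or_lt with rfl | hs
    · exact (hpos θ).le
    · obtain ⟨rfl, h'⟩ := smul_pvec_inj hper hs ht.1 h
      rw [h']
      exact ht.2
  · intro h
    obtain ⟨φ, hφ, e⟩ := exists_mem_Ico_smul_pvec_eq θ
    exact ⟨φ, hφ, s, ⟨hs, by rwa [← apply_eq_of_pvec_eq hper e]⟩, by rw [e]⟩

lemma isCompact_image_smul_pvec {a b : ℝ → ℝ} (ha : ContinuousOn a (Set.Icc 0 (2 * π)))
    (hb : ContinuousOn b (Set.Icc 0 (2 * π))) (hab : ∀ θ, a θ ≤ b θ) :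
    IsCompact {x | ∃ θ ∈ Set.Icc (0 : ℝ) (2 * π), ∃ s ∈ Set.Icc (a θ) (b θ), x = s • pvec θ} := by
  have hK : IsCompact (Set.Icc (0 : ℝ) (2 * π) ×ˢ Set.Icc (0 : ℝ) 1) :=
    isCompact_Icc.prod isCompact_Icc
  have hfst : ContinuousOn (fun q : ℝ × ℝ => q.1) (Set.Icc (0 : ℝ) (2 * π) ×ˢ Set.Icc (0 : ℝ) 1) :=
    continuous_fst.continuousOn
  have hm : Set.MapsTo (fun q : ℝ × ℝ => q.1) (Set.Icc (0 : ℝ) (2 * π) ×ˢ Set.Icc (0 : ℝ) 1)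
      (Set.Icc 0 (2 * π)) := fun q hq => hq.1
  have hc : ContinuousOn (fun q : ℝ × ℝ => (a q.1 + q.2 * (b q.1 - a q.1)) • pvec q.1)
      (Set.Icc (0 : ℝ) (2 * π) ×ˢ Set.Icc (0 : ℝ) 1) := by
    have h1 := ha.comp hfst hm
    have h2 := hb.comp hfst hm
    exact (h1.add (continuous_snd.continuousOn.mul (h2.sub h1))).smul
      (continuous_pvec.comp continuous_fst).continuousOn
  convert hK.image_of_continuousOn hc using 1
  ext x
  constructor
  · rintro ⟨θ, hθ, s, hs, rfl⟩
    rcases (hab θ).eq_or_lt with e | e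
    · refine ⟨(θ, 0), ⟨hθ, by simp⟩, ?_⟩
      have : s = a θ := le_antisymm (e ▸ hs.2) hs.1
      simp [this]
    · have e' : 0 < b θ - a θ := by linarith
      refine ⟨(θ, (s - a θ) / (b θ - a θ)), ⟨hθ, ?_, ?_⟩, ?_⟩
      · exact div_nonneg (by linarith [hs.1]) e'.le
      · exact (div_le_one e').2 (by linarith [hs.2])
      · simp only
        rw [div_mul_cancel₀ _ e'.ne']
        congr 1
        ring
  · rintro ⟨⟨θ, t⟩, ⟨hθ, ht⟩, rfl⟩
    have := hab θ
    refine ⟨θ, hθ, _, ⟨?_, ?_⟩, rfl⟩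
    · have := mul_nonneg ht.1 (sub_nonneg.2 this)
      simp only at *
      linarith
    · have := mul_le_mul_of_nonneg_right ht.2 (sub_nonneg.2 this)
      simp only at *
      linarith

lemma exists_radial_bound (hper : Function.Periodic R (2 * π))
    (hc : ContinuousOn R (Set.Icc 0 (2 * π))) : ∃ M, ∀ θ, R θ ≤ M := by
  obtain ⟨M, hM⟩ := (isCompact_Icc.image_of_continuousOn hc).bddAbove
  refine ⟨M, fun θ => ?_⟩
  obtain ⟨φ, hφ, e⟩ := hper.exists_mem_Ico₀ Real.two_pi_pos θ
  rw [e]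
  exact hM ⟨φ, Set.Ico_subset_Icc_self hφ, rfl⟩

lemma isCompact_closedStar (hper : Function.Periodic R (2 * π)) (hpos : ∀ θ, 0 < R θ)
    (hc : ContinuousOn R (Set.Icc 0 (2 * π))) : IsCompact (closedStar R) := by
  convert isCompact_image_smul_pvec continuousOn_const hc (fun θ => (hpos θ).le) using 1
  ext x
  constructor
  · rintro ⟨θ, hθ, h⟩
    exact ⟨θ, Set.Ico_subset_Icc_self hθ, h⟩
  · rintro ⟨θ, -, s, hs, rfl⟩
    exact (smul_pvec_mem_closedStar hper hpos hs.1 θ).2 hs.2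

lemma isOpen_starDomain (hper : Function.Periodic R (2 * π)) (hpos : ∀ θ, 0 < R θ)
    (hc : ContinuousOn R (Set.Icc 0 (2 * π))) : IsOpen (starDomain R) := by
  obtain ⟨M, hM⟩ := exists_radial_bound hper hc
  have hK := isCompact_image_smul_pvec hc continuousOn_const hM
  suffices h : starDomain R = Metric.ball 0 M \ {x | ∃ θ ∈ Set.Icc (0 : ℝ) (2 * π),
      ∃ s ∈ Set.Icc (R θ) M, x = s • pvec θ} by
    rw [h]
    exact Metric.isOpen_ball.sdiff hK.isClosed
  ext x
  constructor
  · rintro ⟨θ, hθ, s, hs, rfl⟩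
    refine ⟨?_, ?_⟩
    · rw [mem_ball_zero_iff, norm_smul_pvec hs.1]
      exact hs.2.trans_le (hM θ)
    · rintro ⟨φ, hφ, t, ht, h⟩
      obtain ⟨rfl, h'⟩ := smul_pvec_inj hper ((hpos φ).trans_le ht.1) hs.1 h.symm
      rw [h'] at ht
      exact absurd hs.2 (not_lt.2 ht.1)
  · rintro ⟨hx, hn⟩
    obtain ⟨θ, hθ⟩ := exists_eq_norm_smul_pvec x
    rw [hθ, smul_pvec_mem_starDomain hper hpos (norm_nonneg x)]
    by_contra! h
    obtain ⟨φ, hφ, e⟩ := exists_mem_Ico_smul_pvec_eq θ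
    refine hn ⟨φ, Set.Ico_subset_Icc_self hφ, ‖x‖, ⟨?_, ?_⟩, ?_⟩
    · rwa [← apply_eq_of_pvec_eq hper e]
    · rw [mem_ball_zero_iff] at hx
      exact hx.le
    · rw [← e]
      exact hθ

lemma closedStar_diff_starDomain (hper : Function.Periodic R (2 * π)) (hpos : ∀ θ, 0 < R θ) :
    closedStar R \ starDomain R = (fun θ => R θ • pvec θ) '' Set.Ico 0 (2 * π) := by
  ext x
  constructor
  · rintro ⟨⟨θ, hθ, s, hs, rfl⟩, hn⟩
    rw [smul_pvec_mem_starDomain hper hpos hs.1, not_lt] at hn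
    exact ⟨θ, hθ, by simp only [le_antisymm hn hs.2]⟩
  · rintro ⟨θ, hθ, rfl⟩
    refine ⟨(smul_pvec_mem_closedStar hper hpos (hpos θ).le θ).2 le_rfl, fun h => ?_⟩
    exact lt_irrefl _ ((smul_pvec_mem_starDomain hper hpos (hpos θ).le θ).1 h)

lemma starDomain_subset_closedStar : starDomain R ⊆ closedStar R := by
  rintro x ⟨θ, hθ, s, hs, rfl⟩
  exact ⟨θ, hθ, s, Set.Ico_subset_Icc_self hs, rfl⟩

lemma closure_starDomain (hper : Function.Periodic R (2 * π)) (hpos : ∀ θ, 0 < R θ)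
    (hc : ContinuousOn R (Set.Icc 0 (2 * π))) : closure (starDomain R) = closedStar R := by
  apply subset_antisymm
  · exact closure_minimal starDomain_subset_closedStar (isCompact_closedStar hper hpos hc).isClosed
  · rintro x ⟨θ, hθ, s, hs, rfl⟩
    have ht : Filter.Tendsto (fun u : ℝ => (u * s) • pvec θ) (nhdsWithin 1 (Set.Ioo 0 1))
        (nhds (s • pvec θ)) := by
      have : Continuous fun u : ℝ => (u * s) • pvec θ := by fun_prop
      have h := (this.tendsto 1).mono_left (nhdsWithin_le_nhds (s := Set.Ioo (0 : ℝ) 1))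
      simpa using h
    have : (nhdsWithin (1 : ℝ) (Set.Ioo 0 1)).NeBot :=
      mem_closure_iff_nhdsWithin_neBot.1 (by rw [closure_Ioo (by norm_num)]; simp)
    refine mem_closure_of_tendsto ht ?_
    filter_upwards [self_mem_nhdsWithin] with u hu
    rw [smul_pvec_mem_starDomain hper hpos (mul_nonneg hu.1.le hs.1)]
    have := hpos θ
    nlinarith [hu.1, hu.2, hs.1, hs.2]

lemma interior_closedStar (hper : Function.Periodic R (2 * π)) (hpos : ∀ θ, 0 < R θ)
    (hc : ContinuousOn R (Set.Icc 0 (2 * π))) : interior (closedStar R) = starDomain R := by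
  apply subset_antisymm
  · intro x hx
    obtain ⟨θ, hθ, s, hs, rfl⟩ := interior_subset hx
    have hcont : Continuous fun u : ℝ => (u * s) • pvec θ := by fun_prop
    have hmem : ∀ᶠ u in nhdsWithin (1 : ℝ) (Set.Ioi 1), (u * s) • pvec θ ∈ closedStar R := by
      have h1 : (fun u : ℝ => (u * s) • pvec θ) ⁻¹' interior (closedStar R) ∈ nhds (1 : ℝ) :=
        (isOpen_interior.preimage hcont).mem_nhds (by simpa using hx)
      filter_upwards [nhdsWithin_le_nhds h1] with u hu
      exact interior_subset hu
    obtain ⟨u, hu, hu1⟩ := (hmem.and self_mem_nhdsWithin).exists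
    have hu1 : 1 < u := hu1
    rw [smul_pvec_mem_closedStar hper hpos (mul_nonneg (by linarith) hs.1)] at hu
    rw [smul_pvec_mem_starDomain hper hpos hs.1]
    have := hpos θ
    by_contra! h
    nlinarith [hs.1, hs.2]
  · exact interior_maximal starDomain_subset_closedStar (isOpen_starDomain hper hpos hc)

lemma frontier_starDomain (hper : Function.Periodic R (2 * π)) (hpos : ∀ θ, 0 < R θ)
    (hc : ContinuousOn R (Set.Icc 0 (2 * π))) :
    frontier (starDomain R) = (fun θ => R θ • pvec θ) '' Set.Ico 0 (2 * π) := by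
  rw [frontier, closure_starDomain hper hpos hc, (isOpen_starDomain hper hpos hc).interior_eq,
    closedStar_diff_starDomain hper hpos]

lemma frontier_closedStar (hper : Function.Periodic R (2 * π)) (hpos : ∀ θ, 0 < R θ)
    (hc : ContinuousOn R (Set.Icc 0 (2 * π))) :
    frontier (closedStar R) = (fun θ => R θ • pvec θ) '' Set.Ico 0 (2 * π) := by
  rw [frontier, (isCompact_closedStar hper hpos hc).isClosed.closure_eq,
    interior_closedStar hper hpos hc, closedStar_diff_starDomain hper hpos]

lemma injOn_smul_pvec (hpos : ∀ θ, 0 < R θ) :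
    Set.InjOn (fun θ => R θ • pvec θ) (Set.Ico 0 (2 * π)) := by
  intro θ hθ φ hφ h
  simp only at h
  have hp : pvec θ = pvec φ := by
    have e : R θ = R φ := by
      rw [← norm_smul_pvec (hpos θ).le θ, h, norm_smul_pvec (hpos φ).le]
    rw [e] at h
    exact smul_right_injective _ (hpos φ).ne' h
  have hc : Real.cos θ = Real.cos φ := congrArg (fun x => x 0) hp
  have hs : Real.sin θ = Real.sin φ := congrArg (fun x => x 1) hp
  obtain ⟨k, hk⟩ := Real.Angle.angle_eq_iff_two_pi_dvd_sub.1 (Real.Angle.cos_sin_inj hc hs)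
  have h1 : (k : ℝ) < 1 := by
    by_contra! h
    nlinarith [hθ.2, hφ.1, Real.two_pi_pos]
  have h2 : (-1 : ℝ) < k := by
    by_contra! h
    nlinarith [hφ.2, hθ.1, Real.two_pi_pos]
  have : k = 0 := by
    have h1 : k < 1 := by exact_mod_cast h1
    have h2 : -1 < k := by exact_mod_cast h2
    omega
  rw [this] at hk
  simp at hk
  linarith

end Star

/-- The radial function, on the angular sector `[a, b]`, of the line through the points with polar
coordinates `(a, ρ)` and `(b, σ)`. -/
noncomputable def chordRadius (a b ρ σ θ : ℝ) : ℝ :=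
  Real.sin (b - a) / (Real.sin (b - θ) / ρ + Real.sin (θ - a) / σ)

section Chord

variable {a b ρ σ : ℝ}

lemma sin_sub_smul_pvec (a b θ : ℝ) :
    Real.sin (b - a) • pvec θ = Real.sin (b - θ) • pvec a + Real.sin (θ - a) • pvec b := by
  ext i
  fin_cases i
  · change Real.sin (b - a) * Real.cos θ =
      Real.sin (b - θ) * Real.cos a + Real.sin (θ - a) * Real.cos b
    simp only [Real.sin_sub]
    ring
  · change Real.sin (b - a) * Real.sin θ =
      Real.sin (b - θ) * Real.sin a + Real.sin (θ - a) * Real.sin b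
    simp only [Real.sin_sub]
    ring

lemma chordRadius_denom_pos (hab : a < b) (hba : b - a ≤ π / 2) (hρ : 0 < ρ) (hσ : 0 < σ) {θ : ℝ}
    (hθ : θ ∈ Set.Icc a b) : 0 < Real.sin (b - θ) / ρ + Real.sin (θ - a) / σ := by
  have hpi := Real.pi_pos
  rcases hθ.1.eq_or_lt with h | h
  · subst h
    have : 0 < Real.sin (b - a) := Real.sin_pos_of_pos_of_lt_pi (by linarith) (by linarith)
    simp only [sub_self, Real.sin_zero, zero_div, add_zero]
    positivity
  · have h1 : 0 < Real.sin (θ - a) :=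
      Real.sin_pos_of_pos_of_lt_pi (by linarith) (by linarith [hθ.2])
    have h2 : 0 ≤ Real.sin (b - θ) :=
      Real.sin_nonneg_of_nonneg_of_le_pi (by linarith [hθ.2]) (by linarith)
    positivity

lemma chordRadius_left (hab : a < b) (hba : b - a ≤ π / 2) :
    chordRadius a b ρ σ a = ρ := by
  have : 0 < Real.sin (b - a) :=
    Real.sin_pos_of_pos_of_lt_pi (by linarith) (by linarith [Real.pi_pos])
  simp [chordRadius, this.ne', div_div_cancel₀]

lemma chordRadius_right (hab : a < b) (hba : b - a ≤ π / 2) :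
    chordRadius a b ρ σ b = σ := by
  have : 0 < Real.sin (b - a) :=
    Real.sin_pos_of_pos_of_lt_pi (by linarith) (by linarith [Real.pi_pos])
  simp [chordRadius, this.ne', div_div_cancel₀]

lemma continuousOn_chordRadius (hab : a < b) (hba : b - a ≤ π / 2) (hρ : 0 < ρ) (hσ : 0 < σ) :
    ContinuousOn (chordRadius a b ρ σ) (Set.Icc a b) := by
  unfold chordRadius
  refine ContinuousOn.div (by fun_prop) (by fun_prop) fun θ hθ => ?_
  exact (chordRadius_denom_pos hab hba hρ hσ hθ).ne'

lemma half_le_chordRadius (hab : a < b) (hba : b - a ≤ π / 2) {m : ℝ} (hm : 0 < m) (hρ : m ≤ ρ)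
    (hσ : m ≤ σ) {θ : ℝ} (hθ : θ ∈ Set.Icc a b) : m / 2 ≤ chordRadius a b ρ σ θ := by
  have hρ0 := hm.trans_le hρ
  have hσ0 := hm.trans_le hσ
  have hpi := Real.pi_pos
  have hmono : ∀ t, 0 ≤ t → t ≤ b - a → 0 ≤ Real.sin t ∧ Real.sin t ≤ Real.sin (b - a) :=
    fun t ht htb => ⟨Real.sin_nonneg_of_nonneg_of_le_pi ht (by linarith),
      Real.sin_le_sin_of_le_of_le_pi_div_two (by linarith) hba htb⟩
  obtain ⟨h1, h1'⟩ := hmono (b - θ) (by linarith [hθ.2]) (by linarith [hθ.1])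
  obtain ⟨h2, h2'⟩ := hmono (θ - a) (by linarith [hθ.1]) (by linarith [hθ.2])
  rw [chordRadius, le_div_iff₀ (chordRadius_denom_pos hab hba hρ0 hσ0 hθ)]
  have h3 := h1.trans h1'
  have e1 : Real.sin (b - θ) / ρ ≤ Real.sin (b - a) / m := by gcongr
  have e2 : Real.sin (θ - a) / σ ≤ Real.sin (b - a) / m := by gcongr
  calc m / 2 * (Real.sin (b - θ) / ρ + Real.sin (θ - a) / σ)
      ≤ m / 2 * (Real.sin (b - a) / m + Real.sin (b - a) / m) := by gcongr
    _ = Real.sin (b - a) := by field_simp; ring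

lemma chordRadius_smul_pvec (hab : a < b) (hba : b - a ≤ π / 2) (hρ : 0 < ρ) (hσ : 0 < σ) {θ : ℝ}
    (hθ : θ ∈ Set.Icc a b) :
    chordRadius a b ρ σ θ • pvec θ =
      AffineMap.lineMap (ρ • pvec a) (σ • pvec b)
        (Real.sin (θ - a) / σ / (Real.sin (b - θ) / ρ + Real.sin (θ - a) / σ)) := by
  have hD := chordRadius_denom_pos hab hba hρ hσ hθ
  set D := Real.sin (b - θ) / ρ + Real.sin (θ - a) / σ with hDdef
  have e1 : 1 - Real.sin (θ - a) / σ / D = Real.sin (b - θ) / ρ / D := by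
    rw [eq_div_iff hD.ne', sub_mul, div_mul_cancel₀ _ hD.ne', hDdef]
    ring
  rw [AffineMap.lineMap_apply_module, e1, chordRadius, ← hDdef, div_eq_inv_mul, mul_smul,
    sin_sub_smul_pvec, smul_add, smul_smul, smul_smul, smul_smul, smul_smul]
  congr 2
  · field_simp
  · field_simp

lemma image_chordRadius_smul_pvec (hab : a < b) (hba : b - a ≤ π / 2) (hρ : 0 < ρ) (hσ : 0 < σ) :
    (fun θ => chordRadius a b ρ σ θ • pvec θ) '' Set.Icc a b =
      segment ℝ (ρ • pvec a) (σ • pvec b) := by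
  have hpi := Real.pi_pos
  have hs : 0 < Real.sin (b - a) := Real.sin_pos_of_pos_of_lt_pi (by linarith) (by linarith)
  set g : ℝ → ℝ := fun θ => Real.sin (θ - a) / σ / (Real.sin (b - θ) / ρ + Real.sin (θ - a) / σ)
  have hg : g '' Set.Icc a b = Set.Icc 0 1 := by
    apply subset_antisymm
    · rintro _ ⟨θ, hθ, rfl⟩
      have hD := chordRadius_denom_pos hab hba hρ hσ hθ
      have h1 : 0 ≤ Real.sin (θ - a) / σ := div_nonneg
        (Real.sin_nonneg_of_nonneg_of_le_pi (by linarith [hθ.1]) (by linarith [hθ.2])) hσ.le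
      have h2 : 0 ≤ Real.sin (b - θ) / ρ := div_nonneg
        (Real.sin_nonneg_of_nonneg_of_le_pi (by linarith [hθ.2]) (by linarith [hθ.1])) hρ.le
      exact ⟨div_nonneg h1 hD.le, (div_le_one hD).2 (by linarith)⟩
    · have hc : ContinuousOn g (Set.Icc a b) :=
        ContinuousOn.div (by fun_prop) (by fun_prop) fun θ hθ =>
          (chordRadius_denom_pos hab hba hρ hσ hθ).ne'
      have h := intermediate_value_Icc hab.le hc
      have h0 : g a = 0 := by simp [g]
      have h1 : g b = 1 := by simp [g, hs.ne', hσ.ne']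
      rwa [h0, h1] at h
  rw [segment_eq_image_lineMap, ← hg, Set.image_image]
  exact Set.image_congr fun θ hθ => chordRadius_smul_pvec hab hba hρ hσ hθ

end Chord

/-- The angle `2πi/N`. -/
noncomputable def node (N : ℕ) (i : ℤ) : ℝ := 2 * π * i / N

/-- The radial function of the inscribed polygon. -/
noncomputable def polyRadius (r : ℝ → ℝ) (N : ℕ) (θ : ℝ) : ℝ :=
  chordRadius (node N ⌊θ * N / (2 * π)⌋) (node N (⌊θ * N / (2 * π)⌋ + 1))
    (r (node N ⌊θ * N / (2 * π)⌋)) (r (node N (⌊θ * N / (2 * π)⌋ + 1))) θ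

section Polygon

variable {r : ℝ → ℝ} {N : ℕ}

lemma node_succ (N : ℕ) (i : ℤ) : node N (i + 1) = node N i + 2 * π / N := by
  simp only [node]
  push_cast
  ring

lemma node_lt_succ (hN : 4 ≤ N) (i : ℤ) : node N i < node N (i + 1) := by
  have : (4 : ℝ) ≤ N := by exact_mod_cast hN
  have : 0 < 2 * π / N := by positivity
  rw [node_succ]
  linarith

lemma node_succ_sub_le (hN : 4 ≤ N) (i : ℤ) : node N (i + 1) - node N i ≤ π / 2 := by
  have : (4 : ℝ) ≤ N := by exact_mod_cast hN
  rw [node_succ, add_sub_cancel_left, div_le_iff₀ (by positivity)]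
  nlinarith [Real.pi_pos]

lemma node_add (hN : 4 ≤ N) (i : ℤ) : node N (i + N) = node N i + 2 * π := by
  have : (4 : ℝ) ≤ N := by exact_mod_cast hN
  simp only [node]
  push_cast
  field_simp

lemma node_zero (N : ℕ) : node N 0 = 0 := by simp [node]

lemma node_self (hN : 4 ≤ N) : node N N = 2 * π := by
  simpa [node_zero] using node_add hN 0

lemma node_le_node (hN : 4 ≤ N) {i j : ℤ} (h : i ≤ j) : node N i ≤ node N j := by
  have : (i : ℝ) ≤ j := by exact_mod_cast h
  have := Real.pi_pos
  unfold node
  gcongr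

lemma mem_Ico_node_floor (hN : 4 ≤ N) (θ : ℝ) :
    θ ∈ Set.Ico (node N ⌊θ * N / (2 * π)⌋) (node N (⌊θ * N / (2 * π)⌋ + 1)) := by
  have hN' : (4 : ℝ) ≤ N := by exact_mod_cast hN
  have hN0 : (0 : ℝ) < N := by linarith
  have h1 := Int.floor_le (θ * N / (2 * π))
  have h2 := Int.lt_floor_add_one (θ * N / (2 * π))
  rw [le_div_iff₀ Real.two_pi_pos] at h1
  rw [div_lt_iff₀ Real.two_pi_pos] at h2
  constructor
  · rw [node, div_le_iff₀ hN0]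
    linarith
  · rw [node, lt_div_iff₀ hN0]
    push_cast
    linarith

lemma floor_eq_of_mem_Ico_node (hN : 4 ≤ N) {i : ℤ} {θ : ℝ}
    (hθ : θ ∈ Set.Ico (node N i) (node N (i + 1))) : ⌊θ * N / (2 * π)⌋ = i := by
  have hN' : (4 : ℝ) ≤ N := by exact_mod_cast hN
  have hN0 : (0 : ℝ) < N := by linarith
  obtain ⟨h1, h2⟩ := hθ
  rw [node, div_le_iff₀ hN0] at h1
  rw [node, lt_div_iff₀ hN0] at h2
  push_cast at h2
  rw [Int.floor_eq_iff, le_div_iff₀ Real.two_pi_pos, div_lt_iff₀ Real.two_pi_pos]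
  exact ⟨by linarith, by linarith⟩

lemma polyRadius_eq (hN : 4 ≤ N) {i : ℤ} {θ : ℝ}
    (hθ : θ ∈ Set.Icc (node N i) (node N (i + 1))) :
    polyRadius r N θ =
      chordRadius (node N i) (node N (i + 1)) (r (node N i)) (r (node N (i + 1))) θ := by
  rcases hθ.2.eq_or_lt with rfl | h
  · rw [polyRadius, floor_eq_of_mem_Ico_node hN ⟨le_rfl, node_lt_succ hN _⟩,
      chordRadius_left (node_lt_succ hN _) (node_succ_sub_le hN _),
      chordRadius_right (node_lt_succ hN _) (node_succ_sub_le hN _)]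
  · rw [polyRadius, floor_eq_of_mem_Ico_node hN ⟨hθ.1, h⟩]

lemma polyRadius_periodic (hper : Function.Periodic r (2 * π)) (hN : 4 ≤ N) :
    Function.Periodic (polyRadius r N) (2 * π) := by
  intro θ
  have hfl : ⌊(θ + 2 * π) * N / (2 * π)⌋ = ⌊θ * N / (2 * π)⌋ + N := by
    rw [← Int.floor_add_natCast]
    congr 1
    field_simp
  simp only [polyRadius, hfl]
  rw [add_right_comm, node_add hN, node_add hN, hper, hper]
  simp only [chordRadius, add_sub_add_right_eq_sub]

lemma half_le_polyRadius {m : ℝ} (hm : 0 < m) (hr : ∀ θ, m ≤ r θ) (hN : 4 ≤ N) (θ : ℝ) :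
    m / 2 ≤ polyRadius r N θ :=
  half_le_chordRadius (node_lt_succ hN _) (node_succ_sub_le hN _) hm (hr _) (hr _)
    (Set.Ico_subset_Icc_self (mem_Ico_node_floor hN θ))

lemma continuousOn_polyRadius (hr : ∀ θ, 0 < r θ) (hN : 4 ≤ N) :
    ContinuousOn (polyRadius r N) (Set.Icc 0 (2 * π)) := by
  have key : ∀ n : ℕ, ContinuousOn (polyRadius r N) (Set.Icc (node N 0) (node N n)) := by
    intro n
    induction n with
    | zero => simp
    | succ n ih =>
      have h : ContinuousOn (polyRadius r N) (Set.Icc (node N n) (node N (n + 1))) :=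
        (continuousOn_chordRadius (node_lt_succ hN _) (node_succ_sub_le hN _) (hr _)
          (hr _)).congr fun θ hθ => polyRadius_eq hN hθ
      have := ih.union_of_isClosed h isClosed_Icc isClosed_Icc
      rw [Set.Icc_union_Icc_eq_Icc (node_le_node hN (by positivity))
        (node_lt_succ hN _).le] at this
      exact_mod_cast this
  have := key N
  rwa [node_zero, node_self hN] at this

lemma image_polyRadius_smul_pvec (hr : ∀ θ, 0 < r θ) (hN : 4 ≤ N) (i : ℤ) :
    (fun θ => polyRadius r N θ • pvec θ) '' Set.Icc (node N i) (node N (i + 1)) =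
      segment ℝ (r (node N i) • pvec (node N i)) (r (node N (i + 1)) • pvec (node N (i + 1))) := by
  rw [← image_chordRadius_smul_pvec (node_lt_succ hN _) (node_succ_sub_le hN _) (hr _) (hr _)]
  exact Set.image_congr fun θ hθ => by rw [polyRadius_eq hN hθ]

lemma exists_mem_Ico_node (hN : 4 ≤ N) {θ : ℝ} (hθ : θ ∈ Set.Ico 0 (2 * π)) :
    ∃ i ∈ Finset.range N, θ ∈ Set.Ico (node N i) (node N (i + 1)) := by
  have h := mem_Ico_node_floor hN θ
  have hN' : (4 : ℝ) ≤ N := by exact_mod_cast hN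
  have h0 : 0 ≤ ⌊θ * N / (2 * π)⌋ := Int.floor_nonneg.2
    (div_nonneg (mul_nonneg hθ.1 (by linarith)) Real.two_pi_pos.le)
  have h1 : ⌊θ * N / (2 * π)⌋ < N := by
    rw [Int.floor_lt, div_lt_iff₀ Real.two_pi_pos]
    push_cast
    nlinarith [hθ.2]
  obtain ⟨i, hi⟩ := Int.eq_ofNat_of_zero_le h0
  rw [hi] at h h1
  exact ⟨i, Finset.mem_range.2 (by exact_mod_cast h1), h⟩

lemma starVertex_eq (r : ℝ → ℝ) (N i : ℕ) : starVertex r N i = r (node N i) • pvec (node N i) := by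
  simp [starVertex, node]

lemma convexHull_insert_zero_pair (p q : EuclideanSpace ℝ (Fin 2)) :
    convexHull ℝ {0, p, q} = {x | ∃ y ∈ segment ℝ p q, ∃ t ∈ Set.Icc (0 : ℝ) 1, x = t • y} := by
  rw [convexHull_insert (Set.insert_nonempty _ _), convexHull_pair]
  ext x
  simp only [mem_convexJoin, Set.mem_singleton_iff, exists_eq_left, segment_eq_image,
    Set.mem_image, Set.mem_ofPred_eq, smul_zero, zero_add]
  constructor
  · rintro ⟨y, hy, t, ht, rfl⟩
    exact ⟨y, hy, t, ht, rfl⟩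
  · rintro ⟨y, hy, t, ht, rfl⟩
    exact ⟨y, hy, t, ht, rfl⟩

lemma starPolygon_eq_closedStar (hper : Function.Periodic r (2 * π)) {m : ℝ} (hm : 0 < m)
    (hr : ∀ θ, m ≤ r θ) (hN : 4 ≤ N) : starPolygon r N = closedStar (polyRadius r N) := by
  have hr0 : ∀ θ, 0 < r θ := fun θ => hm.trans_le (hr θ)
  have hR0 : ∀ θ, 0 < polyRadius r N θ := fun θ =>
    (half_pos hm).trans_le (half_le_polyRadius hm hr hN θ)
  ext x
  simp only [starPolygon, Set.mem_iUnion, convexHull_insert_zero_pair, starVertex_eq,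
    Set.mem_ofPred_eq]
  push_cast
  constructor
  · rintro ⟨i, hi, y, hy, t, ht, rfl⟩
    rw [← image_polyRadius_smul_pvec hr0 hN] at hy
    obtain ⟨θ, hθ, rfl⟩ := hy
    simp only
    rw [smul_smul, smul_pvec_mem_closedStar (polyRadius_periodic hper hN) hR0
      (mul_nonneg ht.1 (hR0 θ).le)]
    exact mul_le_of_le_one_left (hR0 θ).le ht.2
  · rintro ⟨θ, hθ, s, hs, rfl⟩
    obtain ⟨i, hi, h⟩ := exists_mem_Ico_node hN hθ
    refine ⟨i, hi, polyRadius r N θ • pvec θ, ?_, s / polyRadius r N θ,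
      ⟨div_nonneg hs.1 (hR0 θ).le, (div_le_one (hR0 θ)).2 hs.2⟩, ?_⟩
    · rw [← image_polyRadius_smul_pvec hr0 hN]
      exact ⟨θ, Set.Ico_subset_Icc_self h, rfl⟩
    · rw [smul_smul, div_mul_cancel₀ _ (hR0 θ).ne']

end Polygon

section Measure

variable {X : Type*} [MeasurableSpace X] {μ : Measure X} {F : X → ℝ}

lemma abs_setIntegral_sub_setIntegral_le {A B S : Set X} (hA : MeasurableSet A)
    (hB : MeasurableSet B) (hFA : IntegrableOn F A μ) (hFB : IntegrableOn F B μ) (hS : μ S ≠ ⊤)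
    {M : ℝ} (hM : 0 ≤ M) (hAB : A \ B ⊆ S) (hBA : B \ A ⊆ S) (hFM : ∀ x ∈ A ∪ B, |F x| ≤ M) :
    |∫ x in A, F x ∂μ - ∫ x in B, F x ∂μ| ≤ 2 * M * μ.real S := by
  have key : ∀ C D : Set X, C \ D ⊆ S → C ⊆ A ∪ B → |∫ x in C \ D, F x ∂μ| ≤ M * μ.real S := by
    intro C D hCD hC
    have h := norm_setIntegral_le_of_norm_le_const (μ := μ) (f := F) (C := M)
      ((measure_mono hCD).trans_lt hS.lt_top) fun x hx => hFM x (hC hx.1)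
    exact h.trans (mul_le_mul_of_nonneg_left (measureReal_mono hCD hS) hM)
  have h1 := integral_inter_add_sdiff hB hFA
  have h2 := integral_inter_add_sdiff hA hFB
  rw [Set.inter_comm] at h2
  have k1 := abs_le.1 (key A B hAB Set.subset_union_left)
  have k2 := abs_le.1 (key B A hBA Set.subset_union_right)
  rw [abs_le]
  constructor <;> linarith

lemma abs_setIntegral_sub_const_mul_le {A : Set X} (hA : μ A ≠ ⊤) (hF : IntegrableOn F A μ)
    {k δ : ℝ} (hk : ∀ x ∈ A, |F x - k| ≤ δ) :
    |∫ x in A, F x ∂μ - k * μ.real A| ≤ δ * μ.real A := by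
  have h := norm_setIntegral_le_of_norm_le_const (f := fun x => F x - k) hA.lt_top hk
  rw [integral_sub hF (integrableOn_const hA), setIntegral_const, smul_eq_mul, mul_comm _ k] at h
  exact h

lemma abs_setIntegral_sub_setIntegral_le_of_near {A B : Set X} (hA : μ A ≠ ⊤) (hB : μ B ≠ ⊤)
    (hFA : IntegrableOn F A μ) (hFB : IntegrableOn F B μ) {k δ G ℓ η : ℝ} (hδ : 0 ≤ δ)
    (hkA : ∀ x ∈ A, |F x - k| ≤ δ) (hkB : ∀ x ∈ B, |F x - k| ≤ δ) (hG : |k| ≤ G)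
    (hBℓ : μ.real B = ℓ) (hAℓ : ℓ ≤ μ.real A) (hAη : μ.real A ≤ ℓ + η) :
    |∫ x in A, F x ∂μ - ∫ x in B, F x ∂μ| ≤ δ * (2 * ℓ + η) + G * η := by
  have h1 := abs_setIntegral_sub_const_mul_le hA hFA hkA
  have h2 := abs_setIntegral_sub_const_mul_le hB hFB hkB
  have h3 : |k * (μ.real A - μ.real B)| ≤ G * η := by
    rw [abs_mul]
    refine mul_le_mul hG ?_ (abs_nonneg _) ((abs_nonneg _).trans hG)
    rw [abs_le]
    constructor <;> linarith
  have h4 : δ * μ.real A ≤ δ * (ℓ + η) := mul_le_mul_of_nonneg_left hAη hδ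
  rw [hBℓ] at h2 h3
  rw [abs_le] at *
  constructor <;> nlinarith

end Measure

section Length

variable {Y : Type*} [MetricSpace Y] [MeasurableSpace Y] [BorelSpace Y] {c : ℝ → Y} {a b : ℝ}

lemma ofReal_dist_le_hausdorffMeasure_image (hab : a ≤ b) (hc : ContinuousOn c (Set.Icc a b)) :
    ENNReal.ofReal (dist (c a) (c b)) ≤ μH[(1 : ℝ)] (c '' Set.Icc a b) := by
  have hd : ContinuousOn (fun θ => dist (c a) (c θ)) (Set.Icc a b) :=
    (continuous_const.dist continuous_id).comp_continuousOn hc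
  have h1 := intermediate_value_Icc hab hd
  rw [dist_self] at h1
  have hL : LipschitzOnWith 1 (fun y => dist (c a) y) (c '' Set.Icc a b) :=
    (LipschitzWith.dist_right (c a)).lipschitzOnWith
  have h2 := hL.hausdorffMeasure_image_le zero_le_one
  rw [hausdorffMeasure_real, Set.image_image] at h2
  have h3 := (measure_mono h1).trans h2
  simpa using h3

lemma hausdorffMeasure_image_Ico (hab : a < b) :
    μH[(1 : ℝ)] (c '' Set.Ico a b) = μH[(1 : ℝ)] (c '' Set.Icc a b) := by
  have := Measure.nullSingletonClass_hausdorff Y (d := 1) zero_lt_one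
  rw [← Set.Ico_union_right hab.le, Set.image_union, Set.image_singleton]
  apply le_antisymm (measure_mono Set.subset_union_left)
  refine (measure_union_le _ _).trans ?_
  rw [measure_singleton, add_zero]

lemma hausdorffMeasure_image_Icc_le {K : NNReal} (hc : LipschitzOnWith K c (Set.Icc a b)) :
    μH[(1 : ℝ)] (c '' Set.Icc a b) ≤ K * ENNReal.ofReal (b - a) := by
  have h := hc.hausdorffMeasure_image_le zero_le_one
  rw [hausdorffMeasure_real] at h
  simpa using h

end Length

lemma hausdorffMeasureReal_image_le {γ γ' : ℝ → EuclideanSpace ℝ (Fin 2)} {a b C : ℝ} (hab : a < b)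
    (hC : 0 ≤ C) (hγ : ∀ t ∈ Set.Icc a b, HasDerivAt γ (γ' t) t)
    (hγ' : ∀ t ∈ Set.Icc a b, ‖γ' t - γ' a‖ ≤ C * (b - a)) :
    μH[(1 : ℝ)] (γ '' Set.Ico a b) ≠ ⊤ ∧
      dist (γ a) (γ b) ≤ μH[(1 : ℝ)].real (γ '' Set.Ico a b) ∧
      μH[(1 : ℝ)].real (γ '' Set.Ico a b) ≤ dist (γ a) (γ b) + 2 * C * (b - a) ^ 2 := by
  have hba : 0 < b - a := sub_pos.2 hab
  have hcont : ContinuousOn γ (Set.Icc a b) := fun t ht => (hγ t ht).continuousAt.continuousWithinAt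
  have hK0 : 0 ≤ ‖γ' a‖ + C * (b - a) := by positivity
  have hL : LipschitzOnWith (Real.toNNReal (‖γ' a‖ + C * (b - a))) γ (Set.Icc a b) := by
    refine (convex_Icc a b).lipschitzOnWith_of_nnnorm_hasDerivWithin_le
      (fun t ht => (hγ t ht).hasDerivWithinAt) fun t ht => ?_
    rw [← NNReal.coe_le_coe, coe_nnnorm, Real.coe_toNNReal _ hK0]
    have := norm_add_le (γ' a) (γ' t - γ' a)
    rw [add_sub_cancel] at this
    linarith [hγ' t ht]
  have hup := hausdorffMeasure_image_Icc_le hL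
  have hlow := ofReal_dist_le_hausdorffMeasure_image hab.le hcont
  rw [← hausdorffMeasure_image_Ico hab] at hup hlow
  have hup' : μH[(1 : ℝ)] (γ '' Set.Ico a b) ≤
      ENNReal.ofReal ((‖γ' a‖ + C * (b - a)) * (b - a)) := by
    rwa [ENNReal.ofReal_mul hK0]
  have hfin : μH[(1 : ℝ)] (γ '' Set.Ico a b) ≠ ⊤ := (hup'.trans_lt ENNReal.ofReal_lt_top).ne
  refine ⟨hfin, (ENNReal.ofReal_le_iff_le_toReal hfin).1 hlow, ?_⟩
  have h1 : μH[(1 : ℝ)].real (γ '' Set.Ico a b) ≤ (‖γ' a‖ + C * (b - a)) * (b - a) :=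
    ENNReal.toReal_le_of_le_ofReal (by positivity) hup'
  have h2 := (convex_Icc a b).norm_image_sub_le_of_norm_hasDerivWithin_le (C := C * (b - a))
    (f := fun t => γ t - t • γ' a) (f' := fun t => γ' t - γ' a) (x := a) (y := b)
    (fun t ht => by
      have := (hγ t ht).sub ((hasDerivAt_id t).smul_const (γ' a))
      rw [one_smul] at this
      exact this.hasDerivWithinAt)
    hγ' (Set.left_mem_Icc.2 hab.le) (Set.right_mem_Icc.2 hab.le)
  have h3 : (b - a) * ‖γ' a‖ ≤ dist (γ a) (γ b) + C * (b - a) * (b - a) := by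
    rw [Real.norm_of_nonneg hba.le] at h2
    have e : (b - a) • γ' a = (γ b - γ a) - (γ b - b • γ' a - (γ a - a • γ' a)) := by
      rw [sub_smul]
      abel
    have e1 : (b - a) * ‖γ' a‖ = ‖(b - a) • γ' a‖ := by
      rw [norm_smul, Real.norm_of_nonneg hba.le]
    rw [e1, e, dist_comm, dist_eq_norm]
    exact (norm_sub_le _ _).trans (by linarith)
  nlinarith

lemma integrableOn_of_continuous_of_subset {X : Type*} [TopologicalSpace X] [MeasurableSpace X]
    [OpensMeasurableSpace X] [T2Space X] [SecondCountableTopology X] {μ : Measure X} {F : X → ℝ}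
    (hF : Continuous F) {A K : Set X} (hK : IsCompact K) (hA : MeasurableSet A) (hAK : A ⊆ K)
    (hμ : μ A ≠ ⊤) : IntegrableOn F A μ := by
  obtain ⟨M, hM⟩ := hK.exists_bound_of_continuousOn hF.continuousOn
  exact Measure.integrableOn_of_bounded hμ hF.aestronglyMeasurable
    (ae_restrict_of_forall_mem hA fun x hx => hM x (hAK hx))

lemma setIntegral_image_Ico_eq_sum {c : ℝ → EuclideanSpace ℝ (Fin 2)} {N : ℕ} (hN : 4 ≤ N)
    (hc : ContinuousOn c (Set.Icc 0 (2 * π))) (hinj : Set.InjOn c (Set.Ico 0 (2 * π)))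
    {g : EuclideanSpace ℝ (Fin 2) → ℝ} {μ : Measure (EuclideanSpace ℝ (Fin 2))}
    (hg : ∀ i ∈ Finset.range N, IntegrableOn g (c '' Set.Ico (node N i) (node N (i + 1))) μ) :
    ∫ x in c '' Set.Ico 0 (2 * π), g x ∂μ =
      ∑ i ∈ Finset.range N, ∫ x in c '' Set.Ico (node N i) (node N (i + 1)), g x ∂μ := by
  have hsub : ∀ i ∈ Finset.range N, Set.Ico (node N i) (node N (i + 1)) ⊆ Set.Ico 0 (2 * π) := by
    intro i hi
    rw [← node_self hN, ← node_zero N]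
    have := Finset.mem_range.1 hi
    exact Set.Ico_subset_Ico (node_le_node hN (by positivity)) (node_le_node hN (by omega))
  have hU : c '' Set.Ico 0 (2 * π) =
      ⋃ i ∈ Finset.range N, c '' Set.Ico (node N i) (node N (i + 1)) := by
    rw [← Set.image_iUnion₂]
    congr 1
    ext θ
    simp only [Set.mem_iUnion]
    constructor
    · intro hθ
      obtain ⟨i, hi, h⟩ := exists_mem_Ico_node hN hθ
      exact ⟨i, hi, h⟩
    · rintro ⟨i, hi, h⟩
      exact hsub i hi h
  rw [hU]
  refine integral_biUnion_finset _ (fun i hi => ?_) (fun i hi j hj hij => ?_) hg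
  · exact measurableSet_Ico.image_of_continuousOn_injOn
      (hc.mono ((hsub i hi).trans Set.Ico_subset_Icc_self)) (hinj.mono (hsub i hi))
  · rw [Function.onFun, Set.disjoint_left]
    rintro _ ⟨θ, hθ, rfl⟩ ⟨φ, hφ, h⟩
    have e := hinj (hsub j hj hφ) (hsub i hi hθ) h
    rw [e] at hφ
    have h1 := floor_eq_of_mem_Ico_node hN hθ
    have h2 := floor_eq_of_mem_Ico_node hN hφ
    rw [h1] at h2
    exact hij (by exact_mod_cast h2)

section Approximation

variable {rmin rmax : ℝ} {r : ℝ → ℝ} {N : ℕ}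

lemma contDiff_radial_smul_pvec (hr : ContDiff ℝ 2 r) : ContDiff ℝ 2 fun θ => r θ • pvec θ :=
  hr.smul contDiff_pvec

lemma Icc_node_subset (hN : 4 ≤ N) {i : ℕ} (hi : i ∈ Finset.range N) :
    Set.Icc (node N i) (node N (i + 1)) ⊆ Set.Icc 0 (2 * π) := by
  rw [← node_self hN, ← node_zero N]
  have := Finset.mem_range.1 hi
  exact Set.Icc_subset_Icc (node_le_node hN (by positivity)) (node_le_node hN (by omega))

lemma radial_smul_pvec_mem_closedBall (h0 : 0 < rmin) (hb : ∀ θ, r θ ∈ Set.Icc rmin rmax) (θ : ℝ) :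
    r θ • pvec θ ∈ Metric.closedBall 0 rmax := by
  rw [mem_closedBall_zero_iff, norm_smul_pvec (h0.le.trans (hb θ).1)]
  exact (hb θ).2

lemma polyRadius_smul_pvec_mem_segment (h0 : 0 < rmin) (hb : ∀ θ, r θ ∈ Set.Icc rmin rmax)
    (hN : 4 ≤ N) {i : ℤ} {θ : ℝ} (hθ : θ ∈ Set.Icc (node N i) (node N (i + 1))) :
    polyRadius r N θ • pvec θ ∈
      segment ℝ (r (node N i) • pvec (node N i)) (r (node N (i + 1)) • pvec (node N (i + 1))) := by
  rw [← image_polyRadius_smul_pvec (fun θ => h0.trans_le (hb θ).1) hN]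
  exact ⟨θ, hθ, rfl⟩

lemma polyRadius_smul_pvec_mem_closedBall (h0 : 0 < rmin) (hb : ∀ θ, r θ ∈ Set.Icc rmin rmax)
    (hN : 4 ≤ N) (θ : ℝ) : polyRadius r N θ • pvec θ ∈ Metric.closedBall 0 rmax :=
  (convex_closedBall 0 rmax).segment_subset (radial_smul_pvec_mem_closedBall h0 hb _)
    (radial_smul_pvec_mem_closedBall h0 hb _)
    (polyRadius_smul_pvec_mem_segment h0 hb hN
      (Set.Ico_subset_Icc_self (mem_Ico_node_floor hN θ)))

lemma node_left_mem_Icc (hN : 4 ≤ N) (i : ℤ) :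
    node N i ∈ Set.Icc (node N i) (node N (i + 1)) := Set.left_mem_Icc.2 (node_lt_succ hN i).le

lemma node_right_mem_Icc (hN : 4 ≤ N) (i : ℤ) :
    node N (i + 1) ∈ Set.Icc (node N i) (node N (i + 1)) :=
  Set.right_mem_Icc.2 (node_lt_succ hN i).le

lemma norm_sub_le_of_mem_Icc_node {W : Type*} [NormedAddCommGroup W] {K : NNReal} {φ : ℝ → W}
    (hK : LipschitzOnWith K φ (Set.Icc 0 (2 * π))) (hN : 4 ≤ N) {i : ℕ} (hi : i ∈ Finset.range N)
    {θ : ℝ} (hθ : θ ∈ Set.Icc (node N i) (node N (i + 1))) :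
    ‖φ θ - φ (node N i)‖ ≤ K * (2 * π / N) := by
  have hs := Icc_node_subset hN hi
  have h := hK.dist_le_mul θ (hs hθ) (node N i) (hs (node_left_mem_Icc hN i))
  rw [dist_eq_norm] at h
  refine h.trans (mul_le_mul_of_nonneg_left ?_ K.2)
  rw [Real.dist_eq, abs_of_nonneg (by linarith [hθ.1])]
  have := hθ.2
  rw [node_succ] at this
  linarith

lemma norm_polyRadius_smul_pvec_sub_le {K : NNReal}
    (hK : LipschitzOnWith K (fun θ => r θ • pvec θ) (Set.Icc 0 (2 * π))) (h0 : 0 < rmin)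
    (hb : ∀ θ, r θ ∈ Set.Icc rmin rmax) (hN : 4 ≤ N) {i : ℕ} (hi : i ∈ Finset.range N)
    {θ : ℝ} (hθ : θ ∈ Set.Icc (node N i) (node N (i + 1))) :
    ‖polyRadius r N θ • pvec θ - r (node N i) • pvec (node N i)‖ ≤ K * (2 * π / N) :=
  (norm_sub_le_of_mem_segment (polyRadius_smul_pvec_mem_segment h0 hb hN hθ)).trans
    (norm_sub_le_of_mem_Icc_node hK hN hi (node_right_mem_Icc hN i))

lemma hausdorffMeasure_polygon_edge (hr : ∀ θ, 0 < r θ) (hN : 4 ≤ N) (i : ℤ) :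
    μH[(1 : ℝ)] ((fun θ => polyRadius r N θ • pvec θ) '' Set.Ico (node N i) (node N (i + 1))) =
      ENNReal.ofReal (dist (r (node N i) • pvec (node N i))
        (r (node N (i + 1)) • pvec (node N (i + 1)))) := by
  rw [hausdorffMeasure_image_Ico (node_lt_succ hN i), image_polyRadius_smul_pvec hr hN,
    hausdorffMeasure_segment, edist_dist]

lemma abs_arcIntegral_sub_edgeIntegral_le {K₁ K₂ L : NNReal} {G : ℝ}
    {g : EuclideanSpace ℝ (Fin 2) → ℝ} (h0 : 0 < rmin) (hr : ContDiff ℝ 2 r)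
    (hb : ∀ θ, r θ ∈ Set.Icc rmin rmax)
    (hK₁ : LipschitzOnWith K₁ (fun θ => r θ • pvec θ) (Set.Icc 0 (2 * π)))
    (hK₂ : LipschitzOnWith K₂ (deriv fun θ => r θ • pvec θ) (Set.Icc 0 (2 * π)))
    (hL : LipschitzOnWith L g (Metric.closedBall 0 rmax))
    (hG : ∀ x ∈ Metric.closedBall 0 rmax, |g x| ≤ G) (hN : 4 ≤ N) {i : ℕ}
    (hi : i ∈ Finset.range N)
    (hgA : IntegrableOn g
      ((fun θ => r θ • pvec θ) '' Set.Ico (node N i) (node N (i + 1))) μH[(1 : ℝ)])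
    (hgB : IntegrableOn g
      ((fun θ => polyRadius r N θ • pvec θ) '' Set.Ico (node N i) (node N (i + 1))) μH[(1 : ℝ)]) :
    |∫ x in (fun θ => r θ • pvec θ) '' Set.Ico (node N i) (node N (i + 1)), g x ∂μH[(1 : ℝ)] -
      ∫ x in (fun θ => polyRadius r N θ • pvec θ) '' Set.Ico (node N i) (node N (i + 1)),
        g x ∂μH[(1 : ℝ)]| ≤
      (L * K₁ * (2 * K₁ + 4 * K₂) + G * (2 * K₂)) * (2 * π / N) ^ 2 := by
  have hr0 : ∀ θ, 0 < r θ := fun θ => h0.trans_le (hb θ).1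
  have hN' : (4 : ℝ) ≤ N := by exact_mod_cast hN
  set h : ℝ := 2 * π / N with hh
  have hh0 : 0 < h := by positivity
  have hh2 : h ≤ 2 := by
    rw [hh, div_le_iff₀ (by positivity)]
    linarith [Real.pi_le_four]
  have hsub : node N (i + 1) - node N i = h := by rw [node_succ, add_sub_cancel_left]
  set γ : ℝ → EuclideanSpace ℝ (Fin 2) := fun θ => r θ • pvec θ with hγ
  have hdiff : Differentiable ℝ γ := (contDiff_radial_smul_pvec hr).differentiable (by norm_num)
  obtain ⟨hAfin, hAlow, hAup⟩ := hausdorffMeasureReal_image_le (γ := γ) (γ' := deriv γ) (C := K₂)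
    (node_lt_succ hN i) K₂.2 (fun t _ => (hdiff t).hasDerivAt) fun t ht => by
      rw [hsub]
      exact norm_sub_le_of_mem_Icc_node hK₂ hN hi ht
  rw [hsub] at hAup
  have hB := hausdorffMeasure_polygon_edge hr0 hN i
  have hBfin : μH[(1 : ℝ)] ((fun θ => polyRadius r N θ • pvec θ) ''
      Set.Ico (node N i) (node N (i + 1))) ≠ ⊤ := by
    rw [hB]
    exact ENNReal.ofReal_ne_top
  have hBreal : μH[(1 : ℝ)].real ((fun θ => polyRadius r N θ • pvec θ) ''
      Set.Ico (node N i) (node N (i + 1))) = dist (γ (node N i)) (γ (node N (i + 1))) := by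
    rw [Measure.real, hB, ENNReal.toReal_ofReal dist_nonneg]
  have hℓ : dist (γ (node N i)) (γ (node N (i + 1))) ≤ K₁ * h := by
    rw [dist_comm, dist_eq_norm]
    exact norm_sub_le_of_mem_Icc_node hK₁ hN hi (node_right_mem_Icc hN i)
  have hnear : ∀ x ∈ Metric.closedBall (0 : EuclideanSpace ℝ (Fin 2)) rmax,
      ‖x - γ (node N i)‖ ≤ K₁ * h → |g x - g (γ (node N i))| ≤ L * (K₁ * h) := by
    intro x hx hxd
    have := hL.dist_le_mul x hx _ (radial_smul_pvec_mem_closedBall h0 hb (node N i))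
    rw [Real.dist_eq, dist_eq_norm] at this
    exact this.trans (mul_le_mul_of_nonneg_left hxd L.2)
  have hmain := abs_setIntegral_sub_setIntegral_le_of_near hAfin hBfin hgA hgB
    (k := g (γ (node N i))) (δ := L * (K₁ * h)) (G := G) (by positivity)
    (by
      rintro _ ⟨θ, hθ, rfl⟩
      exact hnear _ (radial_smul_pvec_mem_closedBall h0 hb θ)
        (norm_sub_le_of_mem_Icc_node hK₁ hN hi (Set.Ico_subset_Icc_self hθ)))
    (by
      rintro _ ⟨θ, hθ, rfl⟩
      exact hnear _ (polyRadius_smul_pvec_mem_closedBall h0 hb hN θ)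
        (norm_polyRadius_smul_pvec_sub_le hK₁ h0 hb hN hi (Set.Ico_subset_Icc_self hθ)))
    (hG _ (radial_smul_pvec_mem_closedBall h0 hb _)) hBreal hAlow hAup
  refine hmain.trans ?_
  have e1 : 2 * dist (γ (node N i)) (γ (node N (i + 1))) + 2 * K₂ * h ^ 2 ≤
      2 * (K₁ * h) + 2 * K₂ * (2 * h) := by
    have : h ^ 2 ≤ 2 * h := by nlinarith
    gcongr
  calc _ ≤ L * (K₁ * h) * (2 * (K₁ * h) + 2 * K₂ * (2 * h)) + G * (2 * K₂ * h ^ 2) := by gcongr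
    _ = _ := by ring

lemma exists_boundary_integral_bound (h0 : 0 < rmin) (hr : ContDiff ℝ 2 r)
    (hper : Function.Periodic r (2 * π)) (hb : ∀ θ, r θ ∈ Set.Icc rmin rmax)
    {g : EuclideanSpace ℝ (Fin 2) → ℝ} (hg : ContDiff ℝ 1 g) :
    ∃ C ≥ (0 : ℝ), ∀ N : ℕ, 4 ≤ N →
      |∫ x in frontier (starDomain r), g x ∂μH[(1 : ℝ)] -
        ∫ x in frontier (starPolygon r N), g x ∂μH[(1 : ℝ)]| ≤ C / N := by
  have hr0 : ∀ θ, 0 < r θ := fun θ => h0.trans_le (hb θ).1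
  have hγ := contDiff_radial_smul_pvec hr
  have hγ' : ContDiff ℝ 1 (deriv fun θ => r θ • pvec θ) :=
    (contDiff_succ_iff_deriv (n := 1).1 hγ).2.2
  obtain ⟨K₁, hK₁⟩ := hγ.contDiffOn.exists_lipschitzOnWith two_ne_zero
    (convex_Icc 0 (2 * π)) isCompact_Icc
  obtain ⟨K₂, hK₂⟩ := hγ'.contDiffOn.exists_lipschitzOnWith one_ne_zero
    (convex_Icc 0 (2 * π)) isCompact_Icc
  have hball := isCompact_closedBall (0 : EuclideanSpace ℝ (Fin 2)) rmax
  obtain ⟨L, hL⟩ := hg.contDiffOn.exists_lipschitzOnWith one_ne_zero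
    (convex_closedBall (0 : EuclideanSpace ℝ (Fin 2)) rmax) hball
  obtain ⟨G, hG⟩ := hball.exists_bound_of_continuousOn hg.continuous.continuousOn
  have hG0 : 0 ≤ G := (norm_nonneg _).trans (hG _ (radial_smul_pvec_mem_closedBall h0 hb 0))
  refine ⟨(L * K₁ * (2 * K₁ + 4 * K₂) + G * (2 * K₂)) * (2 * π) ^ 2, by positivity, fun N hN => ?_⟩
  have hN' : (4 : ℝ) ≤ N := by exact_mod_cast hN
  have hR0 : ∀ θ, 0 < polyRadius r N θ := fun θ =>
    (half_pos h0).trans_le (half_le_polyRadius h0 (fun θ => (hb θ).1) hN θ)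
  have hpc := continuousOn_polyRadius hr0 hN
  rw [starPolygon_eq_closedStar hper h0 (fun θ => (hb θ).1) hN,
    frontier_closedStar (polyRadius_periodic hper hN) hR0 hpc,
    frontier_starDomain hper hr0 hr.continuous.continuousOn]
  have hgint : ∀ (c : ℝ → EuclideanSpace ℝ (Fin 2)), ContinuousOn c (Set.Icc 0 (2 * π)) →
      Set.InjOn c (Set.Ico 0 (2 * π)) → (∀ θ, c θ ∈ Metric.closedBall 0 rmax) →
      ∀ i ∈ Finset.range N, μH[(1 : ℝ)] (c '' Set.Ico (node N i) (node N (i + 1))) ≠ ⊤ →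
      IntegrableOn g (c '' Set.Ico (node N i) (node N (i + 1))) μH[(1 : ℝ)] := by
    intro c hc hinj hcb i hi hfin
    have hs := Icc_node_subset hN hi
    have hs' : Set.Ico (node N i) (node N (i + 1)) ⊆ Set.Ico 0 (2 * π) := fun θ hθ =>
      ⟨(hs (Set.Ico_subset_Icc_self hθ)).1, hθ.2.trans_le (hs (node_right_mem_Icc hN i)).2⟩
    refine integrableOn_of_continuous_of_subset hg.continuous hball
      (measurableSet_Ico.image_of_continuousOn_injOn
        (hc.mono (hs'.trans Set.Ico_subset_Icc_self)) (hinj.mono hs')) ?_ hfin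
    rintro _ ⟨θ, -, rfl⟩
    exact hcb θ
  have hc₁ := hγ.continuous.continuousOn (s := Set.Icc 0 (2 * π))
  have hc₂ : ContinuousOn (fun θ => polyRadius r N θ • pvec θ) (Set.Icc 0 (2 * π)) :=
    hpc.smul continuous_pvec.continuousOn
  have hi₁ := hgint _ hc₁ (injOn_smul_pvec hr0) (radial_smul_pvec_mem_closedBall h0 hb)
  have hi₂ := hgint _ hc₂ (injOn_smul_pvec hR0) (polyRadius_smul_pvec_mem_closedBall h0 hb hN)
  have hfin₁ : ∀ i ∈ Finset.range N,
      μH[(1 : ℝ)] ((fun θ => r θ • pvec θ) '' Set.Ico (node N i) (node N (i + 1))) ≠ ⊤ := by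
    intro i hi
    rw [hausdorffMeasure_image_Ico (node_lt_succ hN i)]
    exact ((hausdorffMeasure_image_Icc_le (hK₁.mono (Icc_node_subset hN hi))).trans_lt
      (ENNReal.mul_lt_top ENNReal.coe_lt_top ENNReal.ofReal_lt_top)).ne
  have hfin₂ : ∀ i ∈ Finset.range N, μH[(1 : ℝ)] ((fun θ => polyRadius r N θ • pvec θ) ''
      Set.Ico (node N i) (node N (i + 1))) ≠ ⊤ := by
    intro i hi
    rw [hausdorffMeasure_polygon_edge hr0 hN i]
    exact ENNReal.ofReal_ne_top
  rw [setIntegral_image_Ico_eq_sum hN hc₁ (injOn_smul_pvec hr0)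
      fun i hi => hi₁ i hi (hfin₁ i hi),
    setIntegral_image_Ico_eq_sum hN hc₂ (injOn_smul_pvec hR0)
      fun i hi => hi₂ i hi (hfin₂ i hi), ← Finset.sum_sub_distrib]
  refine (Finset.abs_sum_le_sum_abs _ _).trans ((Finset.sum_le_sum fun i hi =>
    abs_arcIntegral_sub_edgeIntegral_le h0 hr hb hK₁ hK₂ hL hG hN hi
      (hi₁ i hi (hfin₁ i hi)) (hi₂ i hi (hfin₂ i hi))).trans ?_)
  rw [Finset.sum_const, Finset.card_range, nsmul_eq_mul]
  apply le_of_eq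
  field_simp

lemma smul_pvec_mem_of_between {S : Set (EuclideanSpace ℝ (Fin 2))} (hS : Convex ℝ S)
    {s t u θ : ℝ} (hs : s • pvec θ ∈ S) (hu : u • pvec θ ∈ S) (hst : s ≤ t) (htu : t ≤ u) :
    t • pvec θ ∈ S := by
  have hconv : Convex ℝ ((fun t : ℝ => t • pvec θ) ⁻¹' S) :=
    hS.linear_preimage (LinearMap.toSpanSingleton ℝ _ (pvec θ))
  exact hconv.ordConnected.out hs hu ⟨hst, htu⟩

lemma closedStar_subset_closedBall {R : ℝ → ℝ} {M : ℝ} (hM : ∀ θ, R θ ≤ M) :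
    closedStar R ⊆ Metric.closedBall 0 M := by
  rintro _ ⟨θ, -, s, hs, rfl⟩
  rw [mem_closedBall_zero_iff, norm_smul_pvec hs.1]
  exact hs.2.trans (hM θ)

lemma polyRadius_le (h0 : 0 < rmin) (hb : ∀ θ, r θ ∈ Set.Icc rmin rmax) (hN : 4 ≤ N) (θ : ℝ) :
    polyRadius r N θ ≤ rmax := by
  have h := polyRadius_smul_pvec_mem_closedBall h0 hb hN θ
  rwa [mem_closedBall_zero_iff, norm_smul_pvec] at h
  exact (half_pos h0).le.trans (half_le_polyRadius h0 (fun θ => (hb θ).1) hN θ)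

lemma isCompact_starPolygon (r : ℝ → ℝ) (N : ℕ) : IsCompact (starPolygon r N) :=
  (Finset.range N).isCompact_biUnion fun _ _ => (Set.toFinite _).isCompact_convexHull ℝ

lemma exists_area_integral_bound (h0 : 0 < rmin) (hr : ContDiff ℝ 2 r)
    (hper : Function.Periodic r (2 * π)) (hb : ∀ θ, r θ ∈ Set.Icc rmin rmax)
    {F : EuclideanSpace ℝ (Fin 2) → ℝ} (hF : Continuous F) :
    ∃ C ≥ (0 : ℝ), ∀ N : ℕ, 4 ≤ N →
      |(∫ x in starDomain r, F x) - ∫ x in starPolygon r N, F x| ≤ C / N := by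
  have hr0 : ∀ θ, 0 < r θ := fun θ => h0.trans_le (hb θ).1
  have hrc := hr.continuous.continuousOn (s := Set.Icc 0 (2 * π))
  obtain ⟨K, hK⟩ := (contDiff_radial_smul_pvec hr).contDiffOn.exists_lipschitzOnWith two_ne_zero
    (convex_Icc 0 (2 * π)) isCompact_Icc
  have hball := isCompact_closedBall (0 : EuclideanSpace ℝ (Fin 2)) rmax
  obtain ⟨M, hM⟩ := hball.exists_bound_of_continuousOn hF.continuousOn
  have hM0 : 0 ≤ M := (norm_nonneg _).trans (hM _ (radial_smul_pvec_mem_closedBall h0 hb 0))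
  refine ⟨2 * M * ((K * (2 * π)) ^ 2 * π), by positivity, fun N hN => ?_⟩
  have hN' : (4 : ℝ) ≤ N := by exact_mod_cast hN
  have hR0 : ∀ θ, 0 < polyRadius r N θ := fun θ =>
    (half_pos h0).trans_le (half_le_polyRadius h0 (fun θ => (hb θ).1) hN θ)
  have hRper := polyRadius_periodic hper hN
  have hcomp := isCompact_starPolygon r N
  have hpoly := starPolygon_eq_closedStar hper h0 (fun θ => (hb θ).1) hN
  set S : Set (EuclideanSpace ℝ (Fin 2)) := ⋃ i ∈ Finset.range N,
    Metric.closedBall (r (node N i) • pvec (node N i)) (K * (2 * π / N))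
  have hnear : ∀ θ ∈ Set.Ico 0 (2 * π), ∀ s : ℝ, (polyRadius r N θ ≤ s ∧ s ≤ r θ ∨
      r θ ≤ s ∧ s ≤ polyRadius r N θ) → s • pvec θ ∈ S := by
    intro θ hθ s hs
    obtain ⟨i, hi, h⟩ := exists_mem_Ico_node hN hθ
    have h := Set.Ico_subset_Icc_self h
    have h1 : r θ • pvec θ ∈
        Metric.closedBall (r (node N i) • pvec (node N i)) (K * (2 * π / N)) :=
      mem_closedBall_iff_norm.2 (norm_sub_le_of_mem_Icc_node hK hN hi h)
    have h2 : polyRadius r N θ • pvec θ ∈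
        Metric.closedBall (r (node N i) • pvec (node N i)) (K * (2 * π / N)) :=
      mem_closedBall_iff_norm.2 (norm_polyRadius_smul_pvec_sub_le hK h0 hb hN hi h)
    refine Set.mem_biUnion hi ?_
    rcases hs with hs | hs
    · exact smul_pvec_mem_of_between (convex_closedBall _ _) h2 h1 hs.1 hs.2
    · exact smul_pvec_mem_of_between (convex_closedBall _ _) h1 h2 hs.1 hs.2
  have hSvol : volume S ≤ ENNReal.ofReal (N * ((K * (2 * π / N)) ^ 2 * π)) := by
    refine (measure_biUnion_finset_le _ _).trans (le_of_eq ?_)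
    simp only [EuclideanSpace.volume_closedBall_fin_two]
    rw [Finset.sum_const, Finset.card_range, nsmul_eq_mul,
      ENNReal.ofReal_mul (p := (N : ℝ)) (by positivity),
      ENNReal.ofReal_mul (p := (K * (2 * π / N)) ^ 2) (by positivity), ENNReal.ofReal_pow (by positivity),
      ENNReal.ofReal_natCast]
  have hSfin : volume S ≠ ⊤ := (hSvol.trans_lt ENNReal.ofReal_lt_top).ne
  have hSreal : volume.real S ≤ N * ((K * (2 * π / N)) ^ 2 * π) :=
    ENNReal.toReal_le_of_le_ofReal (by positivity) hSvol
  have hAB : starDomain r ∪ starPolygon r N ⊆ Metric.closedBall 0 rmax := by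
    rw [hpoly]
    exact Set.union_subset
      (starDomain_subset_closedStar.trans (closedStar_subset_closedBall fun θ => (hb θ).2))
      (closedStar_subset_closedBall (polyRadius_le h0 hb hN))
  have hmain := abs_setIntegral_sub_setIntegral_le (F := F) (μ := volume)
    (isOpen_starDomain hper hr0 hrc).measurableSet hcomp.isClosed.measurableSet
    ((hF.continuousOn.integrableOn_compact (isCompact_closedStar hper hr0 hrc)).mono_set
      starDomain_subset_closedStar)
    (hF.continuousOn.integrableOn_compact hcomp) hSfin hM0
    (by
      rintro x ⟨⟨θ, hθ, s, hs, rfl⟩, hn⟩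
      rw [hpoly, smul_pvec_mem_closedStar hRper hR0 hs.1, not_le] at hn
      exact hnear θ hθ s (Or.inl ⟨hn.le, hs.2.le⟩))
    (by
      rintro x ⟨hx, hn⟩
      rw [hpoly] at hx
      obtain ⟨θ, hθ, s, hs, rfl⟩ := hx
      rw [smul_pvec_mem_starDomain hper hr0 hs.1, not_lt] at hn
      exact hnear θ hθ s (Or.inr ⟨hn, hs.2⟩))
    (fun x hx => hM x (hAB hx))
  refine hmain.trans ((mul_le_mul_of_nonneg_left hSreal (by positivity)).trans (le_of_eq ?_))
  field_simp

lemma ball_subset_starPolygon (hper : Function.Periodic r (2 * π)) (h0 : 0 < rmin)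
    (hr : ∀ θ, rmin ≤ r θ) (hN : 4 ≤ N) : Metric.ball 0 (rmin / 2) ⊆ starPolygon r N := by
  intro x hx
  have hR := half_le_polyRadius h0 hr hN
  obtain ⟨θ, hθ⟩ := exists_eq_norm_smul_pvec x
  rw [starPolygon_eq_closedStar hper h0 hr hN, hθ,
    smul_pvec_mem_closedStar (polyRadius_periodic hper hN) (fun θ => (half_pos h0).trans_le (hR θ))
      (norm_nonneg x)]
  exact (mem_ball_zero_iff.1 hx).le.trans (hR θ)

lemma abs_div_sub_div_le {a a' z z' z₀ α β n : ℝ} (hz₀ : 0 < z₀) (hz : z₀ ≤ z)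
    (hz' : z₀ ≤ z') (ha : |a - a'| ≤ α / n) (hzz : |z - z'| ≤ β / n) :
    |a / z - a' / z'| ≤ (α / z₀ + |a| * β / (z₀ * z₀)) / n := by
  have hzp := hz₀.trans_le hz
  have hzp' := hz₀.trans_le hz'
  have e : a / z - a' / z' = (a - a') / z' - a * (z - z') / (z * z') := by
    field_simp
    ring
  rw [e]
  have hα := (abs_nonneg _).trans ha
  have hβ := (abs_nonneg _).trans hzz
  calc _ ≤ |(a - a') / z'| + |a * (z - z') / (z * z')| := abs_sub _ _
    _ = |a - a'| / z' + |a| * |z - z'| / (z * z') := by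
      rw [abs_div, abs_div, abs_mul, abs_of_pos hzp', abs_of_pos (mul_pos hzp hzp')]
    _ ≤ α / n / z₀ + |a| * (β / n) / (z₀ * z₀) := by gcongr
    _ = _ := by ring

end Approximation

/-- the two-dimensional polytope approximation rate
`|J(D) - J(D̃_N)| ≤ K/N` of the shape functional. -/
theorem shape_functional_polygon_approximation
    (rmin rmax : ℝ) (h0 : 0 < rmin) (h1 : rmin ≤ rmax)
    (r : ℝ → ℝ) (hr : ContDiff ℝ 2 r) (hper : Function.Periodic r (2 * π))
    (hb : ∀ θ, r θ ∈ Set.Icc rmin rmax)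
    (V : EuclideanSpace ℝ (Fin 2) → ℝ) (hV : ContDiff ℝ 1 V)
    (f : EuclideanSpace ℝ (Fin 2) → ℝ) (hf : Continuous f) (hf0 : ∀ x, 0 ≤ f x)
    (κ : ℝ) (hκ : 0 < κ) :
    ∃ K ≥ (0 : ℝ), ∀ N : ℕ, 4 ≤ N →
      |shapeJ V f κ (starDomain r) - shapeJ V f κ (starPolygon r N)| ≤ K / N := by
  have hr0 : ∀ θ, 0 < r θ := fun θ => h0.trans_le (hb θ).1
  have hg : ContDiff ℝ 1 fun x => Real.exp (-V x) := hV.neg.exp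
  obtain ⟨C₁, hC₁, hcost⟩ := exists_area_integral_bound h0 hr hper hb (hf.mul hg.continuous)
  obtain ⟨C₂, hC₂, hboundary⟩ := exists_boundary_integral_bound h0 hr hper hb hg
  obtain ⟨C₃, hC₃, hmass⟩ := exists_area_integral_bound h0 hr hper hb hg.continuous
  set z₀ := ∫ x in Metric.ball (0 : EuclideanSpace ℝ (Fin 2)) (rmin / 2), Real.exp (-V x)
  have hint : ∀ {E : Set (EuclideanSpace ℝ (Fin 2))}, IsCompact E →
      IntegrableOn (fun x => Real.exp (-V x)) E := fun hE =>
    hg.continuous.continuousOn.integrableOn_compact hE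
  have hpos : ∀ E : Set (EuclideanSpace ℝ (Fin 2)),
      0 ≤ᵐ[volume.restrict E] fun x => Real.exp (-V x) :=
    fun E => Filter.Eventually.of_forall fun x => (Real.exp_pos _).le
  have hz₀ : 0 < z₀ := by
    refine (setIntegral_pos_iff_support_of_nonneg_ae (hpos _)
      ((hint (isCompact_closedBall 0 (rmin / 2))).mono_set Metric.ball_subset_closedBall)).2 ?_
    have : Function.support (fun x => Real.exp (-V x)) = Set.univ :=
      Set.eq_univ_of_forall fun x => (Real.exp_pos _).ne'
    rw [this, Set.univ_inter]
    exact Metric.measure_ball_pos _ _ (half_pos h0)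
  have hzD : z₀ ≤ ∫ x in starDomain r, Real.exp (-V x) := by
    refine setIntegral_mono_set ((hint (isCompact_closedStar hper hr0
      hr.continuous.continuousOn)).mono_set starDomain_subset_closedStar) (hpos _)
      (Filter.Eventually.of_forall fun x hx => ?_)
    obtain ⟨θ, hθ⟩ := exists_eq_norm_smul_pvec x
    change x ∈ starDomain r
    rw [hθ, smul_pvec_mem_starDomain hper hr0 (norm_nonneg x)]
    have : ‖x‖ < rmin / 2 := mem_ball_zero_iff.1 hx
    linarith [(hb θ).1]
  have hzP : ∀ N, 4 ≤ N → z₀ ≤ ∫ x in starPolygon r N, Real.exp (-V x) := fun N hN =>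
    setIntegral_mono_set (hint (isCompact_starPolygon r N)) (hpos _)
      (Filter.Eventually.of_forall (ball_subset_starPolygon hper h0 (fun θ => (hb θ).1) hN))
  refine ⟨(C₁ + κ * C₂) / z₀ + |(∫ x in starDomain r, f x * Real.exp (-V x)) +
    κ * ∫ x in frontier (starDomain r), Real.exp (-V x) ∂μH[(1 : ℝ)]| * C₃ / (z₀ * z₀),
    by positivity, fun N hN => ?_⟩
  refine abs_div_sub_div_le hz₀ hzD (hzP N hN) ?_ (hmass N hN)
  have k1 := hcost N hN
  have k2 := mul_le_mul_of_nonneg_left (hboundary N hN) hκ.le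
  rw [← abs_of_pos hκ, ← abs_mul, abs_of_pos hκ, mul_sub] at k2
  rw [add_sub_add_comm, add_div, mul_div_assoc]
  exact (abs_add_le _ _).trans (add_le_add k1 k2)
end
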